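/- arXiv:1701.06610 — 4 statements merged into one kernel-verified Lean document; each statement's English description precedes it below -/
import Mathlib

section
/- Let W₁ : X₁ → P(Y₁) and W₂ : X₂ → P(Y₂) be channels with finite input/output sets, P₁, P₂ probability mass functions on X₁, X₂, and α ∈ (0,1]. For the product channel W(x₁,x₂) := W₁(x₁) ⊗ W₂(x₂) and the product prior P := P₁ ⊗ P₂, the Augustin information is additive: I_α(P; W) = I_α(P₁; W₁) + I_α(P₂; W₂). -/
open scoped BigOperators

/-- A probability mass function on a finite type. -/
def IsPMF {Y : Type*} [Fintype Y] (Q : Y → ℝ) : Prop :=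
  (∀ y, 0 ≤ Q y) ∧ ∑ y, Q y = 1

/-- The power sum appearing in the Rényi divergence; since `(0:ℝ) ^ (1-α) = 0` for `1-α > 0`,
the sum automatically restricts to `y` with `Q y > 0`. -/
noncomputable def rSum {Y : Type*} [Fintype Y] (α : ℝ) (W Q : Y → ℝ) : ℝ :=
  ∑ y, W y ^ α * Q y ^ (1 - α)

/-- Order-`α` Rényi divergence (for `α ∈ (0,1)`), valued in `EReal`, with the convention
that it is `⊤` when the power sum vanishes. -/
noncomputable def rDiv {Y : Type*} [Fintype Y] (α : ℝ) (W Q : Y → ℝ) : EReal :=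
  if rSum α W Q = 0 then ⊤
  else (((1 / (α - 1)) * Real.log (rSum α W Q) : ℝ) : EReal)

/-- Kullback–Leibler divergence, valued in `EReal`, `⊤` unless `W ≪ Q`. -/
noncomputable def kDiv {Y : Type*} [Fintype Y] (W Q : Y → ℝ) : EReal :=
  if ∀ y, Q y = 0 → W y = 0 then
    (((∑ y, if W y = 0 then 0 else W y * Real.log (W y / Q y)) : ℝ) : EReal)
  else ⊤

/-- Order-`α` divergence for `α ∈ (0,1]`: Rényi for `α ≠ 1`, KL for `α = 1`. -/
noncomputable def dA {Y : Type*} [Fintype Y] (α : ℝ) (W Q : Y → ℝ) : EReal :=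
  if α = 1 then kDiv W Q else rDiv α W Q

/-- Conditional divergence `D_α(W‖Q|P) = ∑_x P(x) D_α(W(x)‖Q)`. -/
noncomputable def cDiv {X Y : Type*} [Fintype X] [Fintype Y]
    (α : ℝ) (W : X → Y → ℝ) (Q : Y → ℝ) (P : X → ℝ) : EReal :=
  ∑ x, (P x : EReal) * dA α (W x) Q

/-- Augustin information `I_α(P;W) = inf_Q D_α(W‖Q|P)`. -/
noncomputable def aInfo {X Y : Type*} [Fintype X] [Fintype Y]
    (α : ℝ) (P : X → ℝ) (W : X → Y → ℝ) : EReal :=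
  ⨅ Q ∈ {Q : Y → ℝ | IsPMF Q}, cDiv α W Q P

lemma E_add {X : Type*} [Fintype X] {P : X → ℝ} (hP : ∀ x, 0 ≤ P x) (f g : X → EReal) :
    ∑ x, (P x : EReal) * (f x + g x) = ∑ x, (P x : EReal) * f x + ∑ x, (P x : EReal) * g x := by
  rw [← Finset.sum_add_distrib]
  refine Finset.sum_congr rfl fun x _ => ?_
  exact EReal.left_distrib_of_nonneg_of_ne_top (EReal.coe_nonneg.2 (hP x)) (EReal.coe_ne_top _) _ _

lemma E_mono {X : Type*} [Fintype X] {P : X → ℝ} (hP : ∀ x, 0 ≤ P x) {f g : X → EReal}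
    (h : ∀ x, f x ≤ g x) :
    ∑ x, (P x : EReal) * f x ≤ ∑ x, (P x : EReal) * g x :=
  Finset.sum_le_sum fun x _ => mul_le_mul_of_nonneg_left (h x) (EReal.coe_nonneg.2 (hP x))

lemma coe_sum_mul {X : Type*} (s : Finset X) {P : X → ℝ} (hP : ∀ x, 0 ≤ P x) (c : EReal) :
    ∑ x ∈ s, (P x : EReal) * c = ((∑ x ∈ s, P x : ℝ) : EReal) * c := by
  classical
  induction s using Finset.induction_on with
  | empty => simp
  | insert a s ha ih =>
    rw [Finset.sum_insert ha, Finset.sum_insert ha, ih, EReal.coe_add,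
      EReal.right_distrib_of_nonneg (EReal.coe_nonneg.2 (hP a))
        (EReal.coe_nonneg.2 (Finset.sum_nonneg fun x _ => hP x))]

lemma E_const {X : Type*} [Fintype X] {P : X → ℝ} (hP : IsPMF P) (c : EReal) :
    ∑ x, (P x : EReal) * c = c := by
  rw [coe_sum_mul _ hP.1, hP.2]; simp

lemma coe_mul_sum {X : Type*} (s : Finset X) {r : ℝ} (hr : 0 ≤ r) (f : X → EReal) :
    (r : EReal) * ∑ x ∈ s, f x = ∑ x ∈ s, (r : EReal) * f x := by
  classical
  induction s using Finset.induction_on with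
  | empty => simp
  | insert a s ha ih =>
    rw [Finset.sum_insert ha, Finset.sum_insert ha, ← ih]
    exact EReal.left_distrib_of_nonneg_of_ne_top (EReal.coe_nonneg.2 hr) (EReal.coe_ne_top _) _ _

lemma E_prod {X₁ X₂ : Type*} [Fintype X₁] [Fintype X₂] {P₁ : X₁ → ℝ} {P₂ : X₂ → ℝ}
    (hP₂ : ∀ x, 0 ≤ P₂ x) (f : X₁ × X₂ → EReal) :
    ∑ p : X₁ × X₂, ((P₁ p.1 * P₂ p.2 : ℝ) : EReal) * f p =
      ∑ x₂, (P₂ x₂ : EReal) * ∑ x₁, (P₁ x₁ : EReal) * f (x₁, x₂) := by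
  rw [Fintype.sum_prod_type_right]
  refine Finset.sum_congr rfl fun x₂ _ => ?_
  rw [coe_mul_sum _ (hP₂ x₂)]
  refine Finset.sum_congr rfl fun x₁ _ => ?_
  rw [EReal.coe_mul, mul_comm (P₁ x₁ : EReal), mul_assoc]

lemma kSum_eq {Y : Type*} [Fintype Y] (W Q : Y → ℝ) :
    (∑ y, if W y = 0 then 0 else W y * Real.log (W y / Q y)) =
      ∑ y, W y * Real.log (W y / Q y) := by
  refine Finset.sum_congr rfl fun y _ => ?_
  split_ifs with h <;> simp [h]

lemma rSum_nonneg {Y : Type*} [Fintype Y] {α : ℝ} {W Q : Y → ℝ} (hW : ∀ y, 0 ≤ W y)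
    (hQ : ∀ y, 0 ≤ Q y) : 0 ≤ rSum α W Q :=
  Finset.sum_nonneg fun y _ => mul_nonneg (Real.rpow_nonneg (hW y) _) (Real.rpow_nonneg (hQ y) _)

lemma dA_nonneg {Y : Type*} [Fintype Y] {α : ℝ} (hα : α ∈ Set.Ioc (0 : ℝ) 1) {W Q : Y → ℝ}
    (hW : IsPMF W) (hQ : IsPMF Q) : 0 ≤ dA α W Q := by
  unfold dA
  split_ifs with h1
  · unfold kDiv
    split_ifs with h
    · rw [kSum_eq]
      apply EReal.coe_nonneg.2
      have : ∑ y, (W y - Q y) ≤ ∑ y, W y * Real.log (W y / Q y) := by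
        refine Finset.sum_le_sum fun y _ => ?_
        rcases (hW.1 y).eq_or_lt with h0 | h0
        · rw [← h0]; simpa using hQ.1 y
        have hq : 0 < Q y := (hQ.1 y).lt_of_ne fun h' => h0.ne' (h y h'.symm)
        have := Real.one_sub_inv_le_log_of_pos (div_pos h0 hq)
        have h2 := mul_le_mul_of_nonneg_left this h0.le
        refine le_trans (le_of_eq ?_) h2
        field_simp
      rw [Finset.sum_sub_distrib, hW.2, hQ.2] at this
      linarith
    · exact le_top
  · unfold rDiv
    have ha : α < 1 := lt_of_le_of_ne hα.2 h1
    split_ifs with h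
    · exact le_top
    · apply EReal.coe_nonneg.2
      have h2 : rSum α W Q ≤ 1 := by
        calc rSum α W Q ≤ ∑ y, (α * W y + (1 - α) * Q y) :=
              Finset.sum_le_sum fun y _ => Real.geom_mean_le_arith_mean2_weighted hα.1.le
                (by linarith) (hW.1 y) (hQ.1 y) (by ring)
          _ = 1 := by
              rw [Finset.sum_add_distrib, ← Finset.mul_sum, ← Finset.mul_sum, hW.2, hQ.2]; ring
      apply mul_nonneg_of_nonpos_of_nonpos
      · exact div_nonpos_of_nonneg_of_nonpos zero_le_one (by linarith)
      · exact Real.log_nonpos (rSum_nonneg hW.1 hQ.1) h2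

lemma IsPMF.prod {Y₁ Y₂ : Type*} [Fintype Y₁] [Fintype Y₂] {Q₁ : Y₁ → ℝ} {Q₂ : Y₂ → ℝ}
    (h₁ : IsPMF Q₁) (h₂ : IsPMF Q₂) : IsPMF (fun q : Y₁ × Y₂ => Q₁ q.1 * Q₂ q.2) := by
  refine ⟨fun q => mul_nonneg (h₁.1 _) (h₂.1 _), ?_⟩
  rw [Fintype.sum_prod_type, ← Finset.sum_mul_sum, h₁.2, h₂.2, one_mul]

lemma dA_prod_le {Y₁ Y₂ : Type*} [Fintype Y₁] [Fintype Y₂] {α : ℝ} (hα : α ∈ Set.Ioc (0 : ℝ) 1)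
    {W₁ Q₁ : Y₁ → ℝ} {W₂ Q₂ : Y₂ → ℝ} (hW₁ : IsPMF W₁) (hQ₁ : IsPMF Q₁)
    (hW₂ : IsPMF W₂) (hQ₂ : IsPMF Q₂) :
    dA α (fun q : Y₁ × Y₂ => W₁ q.1 * W₂ q.2) (fun q : Y₁ × Y₂ => Q₁ q.1 * Q₂ q.2) ≤
      dA α W₁ Q₁ + dA α W₂ Q₂ := by
  have n1 := dA_nonneg hα hW₁ hQ₁
  have n2 := dA_nonneg hα hW₂ hQ₂
  have b1 : dA α W₁ Q₁ ≠ ⊥ := (lt_of_lt_of_le EReal.bot_lt_zero n1).ne'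
  have b2 : dA α W₂ Q₂ ≠ ⊥ := (lt_of_lt_of_le EReal.bot_lt_zero n2).ne'
  by_cases t1 : dA α W₁ Q₁ = ⊤
  · rw [t1, EReal.top_add_of_ne_bot b2]; exact le_top
  by_cases t2 : dA α W₂ Q₂ = ⊤
  · rw [t2, EReal.add_top_of_ne_bot b1]; exact le_top
  clear n1 n2 b1 b2
  unfold dA at *
  split_ifs at * with h1
  · unfold kDiv at *
    split_ifs at t1 t2 with k1 k2
    · rw [if_pos, if_pos k1, if_pos k2, kSum_eq, kSum_eq, kSum_eq, ← EReal.coe_add]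
      · apply EReal.coe_le_coe_iff.2
        apply le_of_eq
        have e : ∀ q : Y₁ × Y₂, W₁ q.1 * W₂ q.2 * Real.log (W₁ q.1 * W₂ q.2 / (Q₁ q.1 * Q₂ q.2)) =
            (W₁ q.1 * Real.log (W₁ q.1 / Q₁ q.1)) * W₂ q.2 +
            W₁ q.1 * (W₂ q.2 * Real.log (W₂ q.2 / Q₂ q.2)) := by
          intro q
          by_cases z1 : W₁ q.1 = 0
          · simp [z1]
          by_cases z2 : W₂ q.2 = 0
          · simp [z2]
          have y1 : Q₁ q.1 ≠ 0 := fun h => z1 (k1 _ h)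
          have y2 : Q₂ q.2 ≠ 0 := fun h => z2 (k2 _ h)
          rw [mul_div_mul_comm, Real.log_mul (div_ne_zero z1 y1) (div_ne_zero z2 y2)]
          ring
        rw [Finset.sum_congr rfl fun q _ => e q, Finset.sum_add_distrib, Fintype.sum_prod_type,
          Fintype.sum_prod_type]
        dsimp only
        rw [← Finset.sum_mul_sum, ← Finset.sum_mul_sum, hW₁.2, hW₂.2]
        ring
      · intro q hq
        rcases mul_eq_zero.1 hq with h | h
        · simp [k1 _ h]
        · simp [k2 _ h]
    all_goals simp at t1 t2
  · have e : rSum α (fun q : Y₁ × Y₂ => W₁ q.1 * W₂ q.2) (fun q : Y₁ × Y₂ => Q₁ q.1 * Q₂ q.2) =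
        rSum α W₁ Q₁ * rSum α W₂ Q₂ := by
      unfold rSum
      rw [Finset.sum_mul_sum, Fintype.sum_prod_type]
      refine Finset.sum_congr rfl fun y₁ _ => Finset.sum_congr rfl fun y₂ _ => ?_
      simp only
      rw [Real.mul_rpow (hW₁.1 _) (hW₂.1 _), Real.mul_rpow (hQ₁.1 _) (hQ₂.1 _)]
      ring
    unfold rDiv at *
    split_ifs at t1 t2 with k1 k2
    · simp at t1
    · simp at t1
    · simp at t2
    · rw [if_neg, if_neg k1, if_neg (by assumption), e, Real.log_mul k1 (by assumption), mul_add,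
        EReal.coe_add]
      rw [e]; exact mul_ne_zero k1 (by assumption)

lemma R_pmf {Y₁ Y₂ : Type*} [Fintype Y₁] [Fintype Y₂] {v : Y₂ → ℝ} (hv : IsPMF v)
    {Q : Y₁ × Y₂ → ℝ} (hQ : IsPMF Q) (h : ∀ y₂, ∑ y₁, Q (y₁, y₂) = 0 → v y₂ = 0) :
    IsPMF (fun y₁ => ∑ y₂, v y₂ * (Q (y₁, y₂) / ∑ y, Q (y, y₂))) := by
  refine ⟨fun y₁ => Finset.sum_nonneg fun y₂ _ => mul_nonneg (hv.1 _)
    (div_nonneg (hQ.1 _) (Finset.sum_nonneg fun _ _ => hQ.1 _)), ?_⟩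
  rw [Finset.sum_comm, ← hv.2]
  refine Finset.sum_congr rfl fun y₂ _ => ?_
  rw [← Finset.mul_sum, ← Finset.sum_div]
  by_cases hz : ∑ y₁, Q (y₁, y₂) = 0
  · rw [h _ hz, zero_mul]
  · rw [div_self hz, mul_one]

lemma marg_pmf {Y₁ Y₂ : Type*} [Fintype Y₁] [Fintype Y₂]
    {Q : Y₁ × Y₂ → ℝ} (hQ : IsPMF Q) : IsPMF (fun y₂ => ∑ y₁, Q (y₁, y₂)) := by
  refine ⟨fun y₂ => Finset.sum_nonneg fun _ _ => hQ.1 _, ?_⟩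
  rw [← Fintype.sum_prod_type_right]; exact hQ.2

lemma marg_pmf' {Y₁ Y₂ : Type*} [Fintype Y₁] [Fintype Y₂]
    {Q : Y₁ × Y₂ → ℝ} (hQ : IsPMF Q) : IsPMF (fun y₁ => ∑ y₂, Q (y₁, y₂)) := by
  refine ⟨fun y₂ => Finset.sum_nonneg fun _ _ => hQ.1 _, ?_⟩
  rw [← Fintype.sum_prod_type]; exact hQ.2

lemma marg_zero {Y₁ Y₂ : Type*} [Fintype Y₁] [Fintype Y₂]
    {Q : Y₁ × Y₂ → ℝ} (hQ : IsPMF Q) {y₂ : Y₂} (h : ∑ y₁, Q (y₁, y₂) = 0) (y₁ : Y₁) :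
    Q (y₁, y₂) = 0 :=
  (Finset.sum_eq_zero_iff_of_nonneg fun _ _ => hQ.1 _).1 h y₁ (Finset.mem_univ _)

lemma exists_pos_of_pmf {Y : Type*} [Fintype Y] {W : Y → ℝ} (hW : IsPMF W) : ∃ y, 0 < W y := by
  by_contra! hc
  have : ∑ y, W y ≤ 0 := Finset.sum_nonpos fun y _ => hc y
  rw [hW.2] at this
  linarith

lemma super_add_kl {Y₁ Y₂ : Type*} [Fintype Y₁] [Fintype Y₂]
    {W₂ : Y₂ → ℝ} (hW₂ : IsPMF W₂) {Q : Y₁ × Y₂ → ℝ} (hQ : IsPMF Q) :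
    ∃ R : Y₁ → ℝ, IsPMF R ∧ ∀ W₁ : Y₁ → ℝ, IsPMF W₁ →
      kDiv W₁ R + kDiv W₂ (fun y₂ => ∑ y₁, Q (y₁, y₂)) ≤
        kDiv (fun q : Y₁ × Y₂ => W₁ q.1 * W₂ q.2) Q := by
  by_cases h : ∀ y₂, ∑ y₁, Q (y₁, y₂) = 0 → W₂ y₂ = 0
  · refine ⟨_, R_pmf hW₂ hQ h, fun W₁ hW₁ => ?_⟩
    by_cases h' : ∀ q : Y₁ × Y₂, Q q = 0 → W₁ q.1 * W₂ q.2 = 0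
    swap
    · refine le_of_le_of_eq le_top (Eq.symm ?_)
      unfold kDiv
      rw [if_neg h']
    set R : Y₁ → ℝ := fun y₁ => ∑ y₂, W₂ y₂ * (Q (y₁, y₂) / ∑ y, Q (y, y₂)) with hR
    have hRp : IsPMF R := R_pmf hW₂ hQ h
    have hQ2 := marg_pmf hQ
    have posQ : ∀ y₁ y₂, 0 < W₁ y₁ → 0 < W₂ y₂ → 0 < Q (y₁, y₂) := fun y₁ y₂ h1 h2 =>
      (hQ.1 _).lt_of_ne fun hz => (mul_pos h1 h2).ne' (h' (y₁, y₂) hz.symm)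
    have posQ2 : ∀ y₂, 0 < W₂ y₂ → 0 < ∑ y, Q (y, y₂) := fun y₂ h2 =>
      (hQ2.1 y₂).lt_of_ne fun hz => h2.ne' (h y₂ hz.symm)
    have posR : ∀ y₁, 0 < W₁ y₁ → 0 < R y₁ := by
      intro y₁ h1
      obtain ⟨y₂, h2⟩ := exists_pos_of_pmf hW₂
      refine Finset.sum_pos' (fun y _ => mul_nonneg (hW₂.1 _) (div_nonneg (hQ.1 _) (hQ2.1 y)))
        ⟨y₂, Finset.mem_univ _, mul_pos h2 (div_pos (posQ _ _ h1 h2) (posQ2 _ h2))⟩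
    have hWR : ∀ y₁, R y₁ = 0 → W₁ y₁ = 0 := by
      intro y₁ hz
      by_contra hne
      exact (posR y₁ ((hW₁.1 _).lt_of_ne' hne)).ne' hz
    unfold kDiv
    rw [if_pos hWR, if_pos h, if_pos h', kSum_eq, kSum_eq, kSum_eq, ← EReal.coe_add]
    apply EReal.coe_le_coe_iff.2
    have e1 : ∑ y₁, W₁ y₁ * Real.log (W₁ y₁ / R y₁) +
        ∑ y₂, W₂ y₂ * Real.log (W₂ y₂ / ∑ y₁, Q (y₁, y₂)) =
        ∑ y₁, ∑ y₂, (W₁ y₁ * Real.log (W₁ y₁ / R y₁) * W₂ y₂ +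
          W₁ y₁ * (W₂ y₂ * Real.log (W₂ y₂ / ∑ y₁, Q (y₁, y₂)))) := by
      simp_rw [Finset.sum_add_distrib]
      rw [← Finset.sum_mul_sum, ← Finset.sum_mul_sum, hW₁.2, hW₂.2]
      ring
    rw [e1, Fintype.sum_prod_type]
    refine Finset.sum_le_sum fun y₁ _ => ?_
    rcases (hW₁.1 y₁).eq_or_lt with h1 | h1
    · simp [← h1]
    have key : ∑ y₂, (W₁ y₁ * W₂ y₂ - W₁ y₁ * (W₂ y₂ * (Q (y₁, y₂) / ∑ y, Q (y, y₂))) / R y₁) = 0 := by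
      rw [Finset.sum_sub_distrib, ← Finset.mul_sum, ← Finset.sum_div, ← Finset.mul_sum, hW₂.2]
      change W₁ y₁ * 1 - W₁ y₁ * R y₁ / R y₁ = 0
      rw [mul_div_assoc, div_self (posR _ h1).ne', sub_self]
    rw [← sub_nonneg, ← Finset.sum_sub_distrib, ← key]
    refine Finset.sum_le_sum fun y₂ _ => ?_
    rcases (hW₂.1 y₂).eq_or_lt with h2 | h2
    · simp [← h2]
    have q := posQ _ _ h1 h2
    have q2 := posQ2 _ h2
    have r := posR _ h1
    simp only
    set S := ∑ y, Q (y, y₂)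
    have ht := Real.one_sub_inv_le_log_of_pos (div_pos (mul_pos r q2) q)
    have := mul_le_mul_of_nonneg_left ht (mul_pos h1 h2).le
    refine le_trans (le_of_eq ?_) (this.trans (le_of_eq ?_))
    · rw [inv_div]; field_simp
    · rw [Real.log_div (mul_pos r q2).ne' q.ne', Real.log_mul r.ne' q2.ne',
        Real.log_div (mul_pos h1 h2).ne' q.ne', Real.log_mul h1.ne' h2.ne',
        Real.log_div h1.ne' r.ne', Real.log_div h2.ne' q2.ne']
      ring
  · refine ⟨_, marg_pmf' hQ, fun W₁ hW₁ => le_of_le_of_eq le_top (Eq.symm ?_)⟩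
    unfold kDiv
    rw [if_neg]
    push Not at h
    obtain ⟨y₂, hz, hne⟩ := h
    obtain ⟨y₁, h1⟩ := exists_pos_of_pmf hW₁
    exact fun hc => mul_ne_zero h1.ne' hne (hc (y₁, y₂) (marg_zero hQ hz y₁))

lemma super_add_renyi {Y₁ Y₂ : Type*} [Fintype Y₁] [Fintype Y₂] {α : ℝ} (h0 : 0 < α) (h1 : α < 1)
    {W₂ : Y₂ → ℝ} (hW₂ : IsPMF W₂) {Q : Y₁ × Y₂ → ℝ} (hQ : IsPMF Q) :
    ∃ R : Y₁ → ℝ, IsPMF R ∧ ∀ W₁ : Y₁ → ℝ, IsPMF W₁ →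
      rDiv α W₁ R + rDiv α W₂ (fun y₂ => ∑ y₁, Q (y₁, y₂)) ≤
        rDiv α (fun q : Y₁ × Y₂ => W₁ q.1 * W₂ q.2) Q := by
  have hQ2 := marg_pmf hQ
  -- it suffices to bound the power sums
  suffices H : ∃ R : Y₁ → ℝ, IsPMF R ∧ ∀ W₁ : Y₁ → ℝ, IsPMF W₁ →
      rSum α (fun q : Y₁ × Y₂ => W₁ q.1 * W₂ q.2) Q ≤
        rSum α W₁ R * rSum α W₂ (fun y₂ => ∑ y₁, Q (y₁, y₂)) by
    obtain ⟨R, hR, H⟩ := H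
    refine ⟨R, hR, fun W₁ hW₁ => ?_⟩
    have hle := H W₁ hW₁
    have n0 : 0 ≤ rSum α (fun q : Y₁ × Y₂ => W₁ q.1 * W₂ q.2) Q :=
      rSum_nonneg (fun q => mul_nonneg (hW₁.1 _) (hW₂.1 _)) hQ.1
    have n1 : 0 ≤ rSum α W₁ R := rSum_nonneg hW₁.1 hR.1
    have n2 := rSum_nonneg (α := α) hW₂.1 hQ2.1
    rcases n0.eq_or_lt with hz | hz
    · refine le_of_le_of_eq le_top (Eq.symm ?_)
      unfold rDiv
      rw [if_pos hz.symm]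
    have hp := hz.trans_le hle
    have z1 : rSum α W₁ R ≠ 0 := fun h => by rw [h, zero_mul] at hp; exact lt_irrefl _ hp
    have z2 : rSum α W₂ (fun y₂ => ∑ y₁, Q (y₁, y₂)) ≠ 0 := fun h => by
      rw [h, mul_zero] at hp; exact lt_irrefl _ hp
    unfold rDiv
    rw [if_neg z1, if_neg z2, if_neg hz.ne', ← EReal.coe_add, ← mul_add, ← Real.log_mul z1 z2]
    apply EReal.coe_le_coe_iff.2
    exact mul_le_mul_of_nonpos_left (Real.log_le_log hz hle)
      (div_nonpos_of_nonneg_of_nonpos zero_le_one (by linarith))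
  set Z := rSum α W₂ (fun y₂ => ∑ y₁, Q (y₁, y₂)) with hZ
  have nZ : 0 ≤ Z := rSum_nonneg hW₂.1 hQ2.1
  have ex : ∀ W₁ : Y₁ → ℝ, IsPMF W₁ → rSum α (fun q : Y₁ × Y₂ => W₁ q.1 * W₂ q.2) Q =
      ∑ y₁, W₁ y₁ ^ α * ∑ y₂, W₂ y₂ ^ α * Q (y₁, y₂) ^ (1 - α) := by
    intro W₁ hW₁
    unfold rSum
    rw [Fintype.sum_prod_type]
    refine Finset.sum_congr rfl fun y₁ _ => ?_
    rw [Finset.mul_sum]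
    refine Finset.sum_congr rfl fun y₂ _ => ?_
    simp only
    rw [Real.mul_rpow (hW₁.1 _) (hW₂.1 _), mul_assoc]
  rcases nZ.eq_or_lt with hz | hz
  · refine ⟨_, marg_pmf' hQ, fun W₁ hW₁ => ?_⟩
    rw [← hz, mul_zero, ex W₁ hW₁]
    refine Finset.sum_nonpos fun y₁ _ => mul_nonpos_of_nonneg_of_nonpos
      (Real.rpow_nonneg (hW₁.1 _) _) ?_
    rw [hz]
    exact Finset.sum_le_sum fun y₂ _ => mul_le_mul_of_nonneg_left
      (Real.rpow_le_rpow (hQ.1 _) (Finset.single_le_sum (f := fun y => Q (y, y₂))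
        (fun _ _ => hQ.1 _) (Finset.mem_univ y₁)) (by linarith)) (Real.rpow_nonneg (hW₂.1 _) _)
  set v : Y₂ → ℝ := fun y₂ => W₂ y₂ ^ α * (∑ y₁, Q (y₁, y₂)) ^ (1 - α) / Z with hv
  have hvp : IsPMF v := by
    refine ⟨fun y₂ => div_nonneg (mul_nonneg (Real.rpow_nonneg (hW₂.1 _) _)
      (Real.rpow_nonneg (hQ2.1 y₂) _)) nZ, ?_⟩
    rw [hv, ← Finset.sum_div]
    exact div_self hz.ne'
  have hv0 : ∀ y₂, ∑ y₁, Q (y₁, y₂) = 0 → v y₂ = 0 := by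
    intro y₂ h
    simp only [hv]
    rw [h, Real.zero_rpow (by linarith), mul_zero, zero_div]
  have hR := R_pmf hvp hQ hv0
  refine ⟨_, hR, fun W₁ hW₁ => ?_⟩
  rw [ex W₁ hW₁]
  unfold rSum
  rw [Finset.sum_mul]
  refine Finset.sum_le_sum fun y₁ _ => ?_
  rw [mul_assoc]
  refine mul_le_mul_of_nonneg_left ?_ (Real.rpow_nonneg (hW₁.1 _) _)
  have J := (Real.concaveOn_rpow (p := 1 - α) (by linarith) (by linarith)).le_map_sum
    (t := Finset.univ) (w := v) (p := fun y₂ => Q (y₁, y₂) / ∑ y, Q (y, y₂))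
    (fun y _ => hvp.1 y) hvp.2 (fun y _ => div_nonneg (hQ.1 _) (hQ2.1 y))
  simp only [smul_eq_mul] at J
  refine le_trans (le_of_eq ?_) (mul_le_mul_of_nonneg_right J nZ)
  rw [Finset.sum_mul]
  refine Finset.sum_congr rfl fun y₂ _ => ?_
  by_cases hs : ∑ y, Q (y, y₂) = 0
  · rw [hv0 _ hs, marg_zero hQ hs, Real.zero_rpow (by linarith)]; ring
  · have hsp : 0 < ∑ y, Q (y, y₂) := (hQ2.1 y₂).lt_of_ne' hs
    have := (Real.rpow_pos_of_pos hsp (1 - α)).ne'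
    rw [Real.div_rpow (hQ.1 _) hsp.le]
    simp only [hv]
    field_simp

lemma super_add {Y₁ Y₂ : Type*} [Fintype Y₁] [Fintype Y₂] {α : ℝ} (hα : α ∈ Set.Ioc (0 : ℝ) 1)
    {W₂ : Y₂ → ℝ} (hW₂ : IsPMF W₂) {Q : Y₁ × Y₂ → ℝ} (hQ : IsPMF Q) :
    ∃ R : Y₁ → ℝ, IsPMF R ∧ ∀ W₁ : Y₁ → ℝ, IsPMF W₁ →
      dA α W₁ R + dA α W₂ (fun y₂ => ∑ y₁, Q (y₁, y₂)) ≤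
        dA α (fun q : Y₁ × Y₂ => W₁ q.1 * W₂ q.2) Q := by
  unfold dA
  by_cases h : α = 1
  · simp only [if_pos h]; exact super_add_kl hW₂ hQ
  · simp only [if_neg h]; exact super_add_renyi hα.1 (lt_of_le_of_ne hα.2 h) hW₂ hQ

lemma aInfo_nonneg {X Y : Type*} [Fintype X] [Fintype Y] {α : ℝ} (hα : α ∈ Set.Ioc (0 : ℝ) 1)
    {P : X → ℝ} {W : X → Y → ℝ} (hP : IsPMF P) (hW : ∀ x, IsPMF (W x)) : 0 ≤ aInfo α P W := by
  unfold aInfo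
  refine le_iInf₂ fun Q hQ => ?_
  exact Finset.sum_nonneg fun x _ => mul_nonneg (EReal.coe_nonneg.2 (hP.1 x))
    (dA_nonneg hα (hW x) hQ)

/-- additivity of the Augustin information for product channels and priors. -/
theorem augustin_info_additive {X₁ X₂ Y₁ Y₂ : Type*}
    [Fintype X₁] [Fintype X₂] [Fintype Y₁] [Fintype Y₂]
    [Nonempty X₁] [Nonempty X₂] [Nonempty Y₁] [Nonempty Y₂]
    (α : ℝ) (hα : α ∈ Set.Ioc (0 : ℝ) 1)
    (W₁ : X₁ → Y₁ → ℝ) (hW₁ : ∀ x, IsPMF (W₁ x))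
    (W₂ : X₂ → Y₂ → ℝ) (hW₂ : ∀ x, IsPMF (W₂ x))
    (P₁ : X₁ → ℝ) (hP₁ : IsPMF P₁) (P₂ : X₂ → ℝ) (hP₂ : IsPMF P₂) :
    aInfo α (fun p : X₁ × X₂ => P₁ p.1 * P₂ p.2)
        (fun p (q : Y₁ × Y₂) => W₁ p.1 q.1 * W₂ p.2 q.2) =
      aInfo α P₁ W₁ + aInfo α P₂ W₂ := by
  have b1 : aInfo α P₁ W₁ ≠ ⊥ :=
    (lt_of_lt_of_le EReal.bot_lt_zero (aInfo_nonneg hα hP₁ hW₁)).ne'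
  have b2 : aInfo α P₂ W₂ ≠ ⊥ :=
    (lt_of_lt_of_le EReal.bot_lt_zero (aInfo_nonneg hα hP₂ hW₂)).ne'
  apply le_antisymm
  · refine EReal.le_add_of_forall_gt (Or.inl b1) (Or.inr b2) fun a ha b hb => ?_
    unfold aInfo at ha hb
    simp only [gt_iff_lt, iInf_lt_iff] at ha hb
    obtain ⟨Q₁, hQ₁, ha⟩ := ha
    obtain ⟨Q₂, hQ₂, hb⟩ := hb
    refine le_trans ?_ (add_le_add ha.le hb.le)
    unfold aInfo
    refine (iInf₂_le (fun q : Y₁ × Y₂ => Q₁ q.1 * Q₂ q.2) (IsPMF.prod hQ₁ hQ₂)).trans ?_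
    unfold cDiv
    rw [E_prod hP₂.1]
    calc _ ≤ ∑ x₂, (P₂ x₂ : EReal) * ∑ x₁, (P₁ x₁ : EReal) *
          (dA α (W₁ x₁) Q₁ + dA α (W₂ x₂) Q₂) :=
          E_mono hP₂.1 fun x₂ => E_mono hP₁.1 fun x₁ =>
            dA_prod_le hα (hW₁ x₁) hQ₁ (hW₂ x₂) hQ₂
      _ = _ := by simp_rw [E_add hP₁.1, E_const hP₁, E_add hP₂.1, E_const hP₂]
  · conv_rhs => unfold aInfo
    refine le_iInf₂ fun Q hQ => ?_
    choose R hR hRle using fun x₂ => super_add (Y₁ := Y₁) hα (hW₂ x₂) hQ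
    unfold cDiv
    rw [E_prod hP₂.1]
    calc aInfo α P₁ W₁ + aInfo α P₂ W₂ ≤ ∑ x₂, (P₂ x₂ : EReal) * (aInfo α P₁ W₁ +
            dA α (W₂ x₂) (fun y₂ => ∑ y₁, Q (y₁, y₂))) := by
          rw [E_add hP₂.1, E_const hP₂]
          refine add_le_add le_rfl ?_
          exact iInf₂_le (fun y₂ => ∑ y₁, Q (y₁, y₂)) (marg_pmf hQ)
      _ ≤ ∑ x₂, (P₂ x₂ : EReal) * ∑ x₁, (P₁ x₁ : EReal) *
            (dA α (W₁ x₁) (R x₂) + dA α (W₂ x₂) (fun y₂ => ∑ y₁, Q (y₁, y₂))) := by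
          refine E_mono hP₂.1 fun x₂ => ?_
          rw [E_add hP₁.1, E_const hP₁]
          exact add_le_add (iInf₂_le (R x₂) (hR x₂)) le_rfl
      _ ≤ _ := E_mono hP₂.1 fun x₂ => E_mono hP₁.1 fun x₁ => hRle x₂ (W₁ x₁) (hW₁ x₁)
end

section
/- Let W : X → P(Y) with X, Y finite, ρ : X → ℝ≥0^ℓ, α ∈ (0,1]. With C_α(W,c) := sup_{P: Σ_x P(x)ρ(x) ≤ c} I_α(P;W) and C_α^λ(W) := sup_P [ I_α(P;W) − λ·Σ_x P(x)ρ(x) ], the strong duality C_α(W,c) = inf_{λ ≥ 0} [ C_α^λ(W) + λ·c ] holds for every feasible c (since X is finite). -/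
open scoped BigOperators

/-- Cost-constrained Augustin capacity. -/
noncomputable def ccCap {X Y : Type*} [Fintype X] [Fintype Y] {l : ℕ}
    (α : ℝ) (W : X → Y → ℝ) (ρ : X → Fin l → ℝ) (c : Fin l → ℝ) : EReal :=
  ⨆ P ∈ {P : X → ℝ | IsPMF P ∧ ∀ i, ∑ x, P x * ρ x i ≤ c i}, aInfo α P W


/-- Augustin–Legendre capacity `C_α^λ(W) = sup_P [I_α(P;W) − λ·E_P[ρ]]`. -/
noncomputable def alCap {X Y : Type*} [Fintype X] [Fintype Y] {l : ℕ}
    (α : ℝ) (W : X → Y → ℝ) (ρ : X → Fin l → ℝ) (lam : Fin l → ℝ) : EReal :=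
  ⨆ P ∈ {P : X → ℝ | IsPMF P},
    (aInfo α P W - (((∑ i, lam i * ∑ x, P x * ρ x i) : ℝ) : EReal))


lemma ereal_coe_sum_aux {X : Type*} (s : Finset X) (f : X → ℝ) :
    ((∑ x ∈ s, f x : ℝ) : EReal) = ∑ x ∈ s, (f x : EReal) := by
  classical
  induction s using Finset.induction_on with
  | empty => simp
  | insert a s ha ih => rw [Finset.sum_insert ha, Finset.sum_insert ha, EReal.coe_add, ih]

/-- A form of Ville's theorem of the alternative on the simplex. -/
lemma ville_aux {X κ : Type*} [Fintype X] [Fintype κ] (g : κ → X → ℝ)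
    (h : ∀ P : X → ℝ, IsPMF P → ∃ k, ∑ x, P x * g k x < 0) :
    ∃ μ : κ → ℝ, (∀ k, 0 ≤ μ k) ∧ ∀ P : X → ℝ, IsPMF P → ∑ k, μ k * ∑ x, P x * g k x < 0 := by
  classical
  let L : (X → ℝ) →ₗ[ℝ] (κ → ℝ) :=
    { toFun := fun P k => ∑ x, P x * g k x
      map_add' := by
        intro a b; ext k; simp [add_mul, Finset.sum_add_distrib]
      map_smul' := by
        intro a b; ext k; simp [Finset.mul_sum, mul_assoc] }
  have hLc : Continuous L := L.continuous_of_finiteDimensional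
  have hK : IsCompact (L '' stdSimplex ℝ X) := (isCompact_stdSimplex ℝ X).image hLc
  have hKc : Convex ℝ (L '' stdSimplex ℝ X) := (convex_stdSimplex ℝ X).linear_image L
  have hO : IsClosed (Set.Ici (0 : κ → ℝ)) := isClosed_Ici
  have hOc : Convex ℝ (Set.Ici (0 : κ → ℝ)) := convex_Ici 0
  have hd : Disjoint (L '' stdSimplex ℝ X) (Set.Ici (0 : κ → ℝ)) := by
    rw [Set.disjoint_left]
    rintro _ ⟨P, hP, rfl⟩ h0
    obtain ⟨k, hk⟩ := h P hP
    have := h0 k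
    exact absurd hk (not_lt.mpr this)
  obtain ⟨f, u, v, h1, h2, h3⟩ := geometric_hahn_banach_compact_closed hKc hK hOc hO hd
  have hv : v < 0 := by simpa using h3 0 (by simp)
  have hpos : ∀ k, 0 ≤ f (Pi.single k 1) := by
    intro k
    by_contra hneg
    push Not at hneg
    have h4 := h3 ((v / f (Pi.single k 1)) • Pi.single k 1) (by
      rw [Set.mem_Ici]
      apply smul_nonneg (div_nonneg_of_nonpos hv.le hneg.le)
      exact Pi.single_nonneg.mpr zero_le_one)
    rw [map_smul, smul_eq_mul, div_mul_cancel₀ _ hneg.ne] at h4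
    exact lt_irrefl _ h4
  refine ⟨fun k => f (Pi.single k 1), hpos, fun P hP => ?_⟩
  have h5 := h1 (L P) ⟨P, hP, rfl⟩
  have h6 : f (L P) = ∑ k, f (Pi.single k 1) * ∑ x, P x * g k x := by
    conv_lhs => rw [pi_eq_sum_univ' (L P)]
    rw [map_sum]
    refine Finset.sum_congr rfl fun k _ => ?_
    rw [map_smul, smul_eq_mul, mul_comm]
    rfl
  linarith

lemma rSum_pos_aux {Y : Type*} [Fintype Y] (α : ℝ) {W Q : Y → ℝ} (hW : IsPMF W)
    (hQ : ∀ y, 0 < Q y) : 0 < rSum α W Q := by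
  unfold rSum
  obtain ⟨y, hy⟩ : ∃ y, 0 < W y := by
    by_contra hcon
    push Not at hcon
    have := Finset.sum_nonpos (s := Finset.univ) fun y _ => hcon y
    linarith [hW.2]
  refine Finset.sum_pos' (fun y _ => mul_nonneg (Real.rpow_nonneg (hW.1 y) _)
    (Real.rpow_nonneg (hQ y).le _)) ⟨y, Finset.mem_univ _, ?_⟩
  exact mul_pos (Real.rpow_pos_of_pos hy _) (Real.rpow_pos_of_pos (hQ y) _)

lemma dA_real_aux {Y : Type*} [Fintype Y] (α : ℝ) {W Q : Y → ℝ} (hW : IsPMF W)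
    (hQ : ∀ y, 0 < Q y) : dA α W Q = ((dA α W Q).toReal : EReal) := by
  unfold dA
  split_ifs with h
  · unfold kDiv
    rw [if_pos fun y hy => absurd hy (hQ y).ne', EReal.toReal_coe]
  · unfold rDiv
    rw [if_neg (rSum_pos_aux α hW hQ).ne', EReal.toReal_coe]

lemma dA_shift_aux {Y : Type*} [Fintype Y] {α : ℝ} (hα : α ∈ Set.Ioc (0 : ℝ) 1)
    {W Q Q' : Y → ℝ} (hW : IsPMF W) (hQ : IsPMF Q) (hQ' : ∀ y, 0 < Q' y) (δ : ℝ)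
    (hle : ∀ y, Real.exp (-δ) * Q y ≤ Q' y) : dA α W Q' ≤ dA α W Q + (δ : EReal) := by
  unfold dA
  split_ifs with h
  · unfold kDiv
    rw [if_pos fun y hy => absurd hy (hQ' y).ne']
    split_ifs with h0
    · rw [← EReal.coe_add, EReal.coe_le_coe_iff]
      have : δ = ∑ y, W y * δ := by rw [← Finset.sum_mul, hW.2, one_mul]
      rw [this, ← Finset.sum_add_distrib]
      refine Finset.sum_le_sum fun y _ => ?_
      split_ifs with hy
      · simp [hy]
      · have hWy : 0 < W y := lt_of_le_of_ne (hW.1 y) (Ne.symm hy)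
        have hQy : 0 < Q y := lt_of_le_of_ne (hQ.1 y) fun hh => hy (h0 y hh.symm)
        rw [← mul_add]
        refine mul_le_mul_of_nonneg_left ?_ hWy.le
        have := Real.log_le_log (by positivity) (hle y)
        rw [Real.log_mul (Real.exp_pos _).ne' hQy.ne', Real.log_exp] at this
        rw [Real.log_div hy (hQ' y).ne', Real.log_div hy hQy.ne']
        linarith
    · simp
  · have hα1 : α < 1 := lt_of_le_of_ne hα.2 h
    unfold rDiv
    have hp := rSum_pos_aux α hW hQ'
    rw [if_neg hp.ne']
    split_ifs with h0
    · simp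
    · rw [← EReal.coe_add, EReal.coe_le_coe_iff]
      have hq : 0 < rSum α W Q := lt_of_le_of_ne (Finset.sum_nonneg fun y _ =>
        mul_nonneg (Real.rpow_nonneg (hW.1 y) _) (Real.rpow_nonneg (hQ.1 y) _)) (Ne.symm h0)
      have hs : Real.exp (-δ) ^ (1 - α) * rSum α W Q ≤ rSum α W Q' := by
        unfold rSum
        rw [Finset.mul_sum]
        refine Finset.sum_le_sum fun y _ => ?_
        rw [mul_left_comm, ← Real.mul_rpow (Real.exp_pos _).le (hQ.1 y)]
        refine mul_le_mul_of_nonneg_left ?_ (Real.rpow_nonneg (hW.1 y) _)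
        exact Real.rpow_le_rpow (mul_nonneg (Real.exp_pos _).le (hQ.1 y)) (hle y) (by linarith)
      have hl := Real.log_le_log (by positivity) hs
      rw [Real.log_mul (by positivity) hq.ne', Real.log_rpow (Real.exp_pos _), Real.log_exp] at hl
      have hne : α - 1 < 0 := by linarith
      have h7 : δ = (1 / (α - 1)) * ((α - 1) * δ) := by field_simp
      rw [h7, ← mul_add]
      refine mul_le_mul_of_nonpos_left ?_ (by
        rw [one_div]; exact (inv_lt_zero.mpr hne).le)
      linarith

lemma cDiv_real_aux {X Y : Type*} [Fintype X] [Fintype Y] (α : ℝ) {W : X → Y → ℝ} {Q : Y → ℝ}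
    (hW : ∀ x, IsPMF (W x)) (hQ : ∀ y, 0 < Q y) (P : X → ℝ) :
    cDiv α W Q P = ((∑ x, P x * (dA α (W x) Q).toReal : ℝ) : EReal) := by
  unfold cDiv
  rw [ereal_coe_sum_aux]
  refine Finset.sum_congr rfl fun x _ => ?_
  rw [EReal.coe_mul, ← dA_real_aux α (hW x) hQ]

lemma exists_full_aux {X Y : Type*} [Fintype X] [Fintype Y] [Nonempty Y]
    {α : ℝ} (hα : α ∈ Set.Ioc (0 : ℝ) 1)
    {W : X → Y → ℝ} (hW : ∀ x, IsPMF (W x)) {P : X → ℝ} (hP : IsPMF P) {t : ℝ}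
    (ht : aInfo α P W < (t : EReal)) :
    ∃ Q : Y → ℝ, IsPMF Q ∧ (∀ y, 0 < Q y) ∧ ∑ x, P x * (dA α (W x) Q).toReal < t := by
  unfold aInfo at ht
  simp only [iInf_lt_iff] at ht
  obtain ⟨Q, hQ, hQt⟩ := ht
  have hQ : IsPMF Q := hQ
  obtain ⟨s, hs1, hs2⟩ := EReal.lt_iff_exists_real_btwn.mp hQt
  have hst : s < t := EReal.coe_lt_coe_iff.mp hs2
  set δ := t - s with hδ
  have hδ0 : 0 < δ := by linarith
  set r := Real.exp (-δ) with hr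
  have hr0 : 0 < r := Real.exp_pos _
  have hr1 : r < 1 := by rw [hr, Real.exp_lt_one_iff]; linarith
  have hn : (0 : ℝ) < Fintype.card Y := by exact_mod_cast Fintype.card_pos
  set e : ℝ := (1 - r) / Fintype.card Y with he
  have he0 : 0 < e := div_pos (by linarith) hn
  have hQ'pos : ∀ y, 0 < r * Q y + e := fun y =>
    add_pos_of_nonneg_of_pos (mul_nonneg hr0.le (hQ.1 y)) he0
  refine ⟨fun y => r * Q y + e, ⟨fun y => (hQ'pos y).le, ?_⟩, hQ'pos, ?_⟩
  · rw [Finset.sum_add_distrib, ← Finset.mul_sum, hQ.2]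
    simp only [Finset.sum_const, Finset.card_univ, nsmul_eq_mul]
    rw [he]; field_simp; ring
  · rw [← EReal.coe_lt_coe_iff, ← cDiv_real_aux α hW hQ'pos P]
    have h1 : cDiv α W (fun y => r * Q y + e) P ≤ cDiv α W Q P + (δ : EReal) := by
      have h2 : (δ : EReal) = ∑ x, (P x : EReal) * (δ : EReal) := by
        have : δ = ∑ x, P x * δ := by rw [← Finset.sum_mul, hP.2, one_mul]
        conv_lhs => rw [this]
        rw [ereal_coe_sum_aux]
        simp
      rw [h2]
      unfold cDiv
      rw [← Finset.sum_add_distrib]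
      refine Finset.sum_le_sum fun x _ => ?_
      have hPx : (0 : EReal) ≤ (P x : EReal) := EReal.coe_nonneg.mpr (hP.1 x)
      have h3 := dA_shift_aux hα (hW x) hQ hQ'pos δ (fun y => by
        change r * Q y ≤ _
        linarith)
      calc (P x : EReal) * dA α (W x) (fun y => r * Q y + e)
          ≤ (P x : EReal) * (dA α (W x) Q + (δ : EReal)) := mul_le_mul_of_nonneg_left h3 hPx
        _ = _ := EReal.left_distrib_of_nonneg_of_ne_top hPx (EReal.coe_ne_top _) _ _
    refine lt_of_le_of_lt h1 ?_
    have h4 : (t : EReal) = (s : EReal) + (δ : EReal) := by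
      rw [← EReal.coe_add]; congr 1; linarith
    rw [h4]
    exact EReal.add_lt_add_right_coe hs1 δ

lemma weak_aux {a : EReal} {u v : ℝ} (h : u ≤ v) : a ≤ a - (u : EReal) + (v : EReal) := by
  induction a with
  | bot => simp
  | top => simp
  | coe a =>
    rw [← EReal.coe_sub, ← EReal.coe_add, EReal.coe_le_coe_iff]
    linarith

/-- strong Lagrange duality for the cost-constrained Augustin capacity
(finite input set). -/
theorem ccCap_strong_duality {X Y : Type*} [Fintype X] [Fintype Y]
    [Nonempty X] [Nonempty Y] {l : ℕ} (hl : 0 < l)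
    (α : ℝ) (hα : α ∈ Set.Ioc (0 : ℝ) 1)
    (W : X → Y → ℝ) (hW : ∀ x, IsPMF (W x))
    (ρ : X → Fin l → ℝ) (hρ : ∀ x i, 0 ≤ ρ x i)
    (c : Fin l → ℝ)
    (hc : ∃ P : X → ℝ, IsPMF P ∧ ∀ i, ∑ x, P x * ρ x i ≤ c i) :
    ccCap α W ρ c =
      ⨅ lam ∈ {lam : Fin l → ℝ | ∀ i, 0 ≤ lam i},
        (alCap α W ρ lam + (((∑ i, lam i * c i) : ℝ) : EReal)) := by
  classical
  apply le_antisymm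
  · refine le_iInf₂ fun lam hlam => ?_
    unfold ccCap
    refine iSup₂_le fun P hP => ?_
    have h1 : ∑ i, lam i * ∑ x, P x * ρ x i ≤ ∑ i, lam i * c i :=
      Finset.sum_le_sum fun i _ => mul_le_mul_of_nonneg_left (hP.2 i) (hlam i)
    refine (weak_aux h1).trans ?_
    gcongr
    unfold alCap
    exact le_iSup₂ (f := fun (P : X → ℝ) (_ : P ∈ {P : X → ℝ | IsPMF P}) =>
      (aInfo α P W - (((∑ i, lam i * ∑ x, P x * ρ x i) : ℝ) : EReal))) P hP.1
  · rw [← EReal.le_of_forall_lt_iff_le]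
    intro t ht
    -- open cover of the simplex
    let F : Set (Y → ℝ) := {Q | IsPMF Q ∧ ∀ y, 0 < Q y}
    let d : (Y → ℝ) → X → ℝ := fun Q x => (dA α (W x) Q).toReal
    let G : (F ⊕ Fin l) → X → ℝ := fun k x =>
      Sum.elim (fun Q => d Q.1 x - t) (fun i => c i - ρ x i) k
    have hGl : ∀ (P : X → ℝ), IsPMF P → ∀ Q : F,
        ∑ x, P x * G (Sum.inl Q) x = ∑ x, P x * d Q.1 x - t := by
      intro P hP Q
      simp only [G, Sum.elim_inl, mul_sub, Finset.sum_sub_distrib]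
      rw [← Finset.sum_mul, hP.2, one_mul]
    have hGr : ∀ (P : X → ℝ), IsPMF P → ∀ i : Fin l,
        ∑ x, P x * G (Sum.inr i) x = c i - ∑ x, P x * ρ x i := by
      intro P hP i
      simp only [G, Sum.elim_inr, mul_sub, Finset.sum_sub_distrib]
      rw [← Finset.sum_mul, hP.2, one_mul]
    obtain ⟨S, hS⟩ := (isCompact_stdSimplex ℝ X).elim_finite_subcover
      (fun k : F ⊕ Fin l => {P : X → ℝ | ∑ x, P x * G k x < 0})
      (fun k => isOpen_lt (by fun_prop) continuous_const) (by
        intro P hP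
        have hP : IsPMF P := hP
        rw [Set.mem_iUnion]
        by_cases hf : ∀ i, ∑ x, P x * ρ x i ≤ c i
        · have h1 : aInfo α P W < (t : EReal) := lt_of_le_of_lt
            (le_iSup₂ (f := fun (P : X → ℝ)
              (_ : P ∈ {P : X → ℝ | IsPMF P ∧ ∀ i, ∑ x, P x * ρ x i ≤ c i}) => aInfo α P W)
              P ⟨hP, hf⟩) ht
          obtain ⟨Q, hQ, hQ0, hQt⟩ := exists_full_aux hα hW hP h1
          refine ⟨Sum.inl ⟨Q, hQ, hQ0⟩, ?_⟩
          rw [Set.mem_ofPred_eq, hGl P hP]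
          change ∑ x, P x * (dA α (W x) Q).toReal - t < 0
          linarith
        · push Not at hf
          obtain ⟨i, hi⟩ := hf
          refine ⟨Sum.inr i, ?_⟩
          rw [Set.mem_ofPred_eq, hGr P hP]
          linarith)
    -- finitely many full-support output distributions
    let T : Finset F := S.toLeft
    obtain ⟨μ, hμ0, hμ⟩ := ville_aux
      (fun (k : T ⊕ Fin l) => G (Sum.map (fun q : T => q.1) id k)) (by
        intro P hP
        have := hS hP
        simp only [Set.mem_iUnion] at this
        obtain ⟨k, hk, hkP⟩ := this
        rcases k with q | i
        · exact ⟨Sum.inl ⟨q, Finset.mem_toLeft.mpr hk⟩, hkP⟩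
        · exact ⟨Sum.inr i, hkP⟩)
    have hμ' : ∀ P : X → ℝ, IsPMF P →
        ∑ q : T, μ (Sum.inl q) * (∑ x, P x * d q.1.1 x - t)
          + ∑ i, μ (Sum.inr i) * (c i - ∑ x, P x * ρ x i) < 0 := by
      intro P hP
      have := hμ P hP
      rw [Fintype.sum_sum_type] at this
      simpa only [Sum.map_inl, Sum.map_inr, id, hGl P hP, hGr P hP] using this
    set A := ∑ q : T, μ (Sum.inl q) with hA
    have hA0 : 0 < A := by
      refine lt_of_le_of_ne (Finset.sum_nonneg fun q _ => hμ0 _) fun h0 => ?_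
      have hz := (Finset.sum_eq_zero_iff_of_nonneg
        (fun (q : T) _ => hμ0 (Sum.inl q))).mp h0.symm
      obtain ⟨P, hP, hPc⟩ := hc
      have h1 := hμ' P hP
      rw [Finset.sum_eq_zero (fun q hq => by rw [hz q hq, zero_mul]), zero_add] at h1
      exact absurd h1 (not_lt.mpr (Finset.sum_nonneg fun i _ =>
        mul_nonneg (hμ0 _) (sub_nonneg.mpr (hPc i))))
    refine (iInf₂_le (fun i => μ (Sum.inr i) / A)
      (fun i => div_nonneg (hμ0 _) hA0.le)).trans ?_
    set b := ∑ i, μ (Sum.inr i) / A * c i with hb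
    suffices hsuff : alCap α W ρ (fun i => μ (Sum.inr i) / A) ≤ ((t - b : ℝ) : EReal) by
      calc _ ≤ ((t - b : ℝ) : EReal) + (b : EReal) := by gcongr
        _ = (t : EReal) := by rw [← EReal.coe_add]; congr 1; ring
    unfold alCap
    refine iSup₂_le fun P hP => ?_
    have hP : IsPMF P := hP
    set w := ∑ i, μ (Sum.inr i) / A * ∑ x, P x * ρ x i with hw
    have h2 := hμ' P hP
    have h3 : ∑ i, μ (Sum.inr i) * (c i - ∑ x, P x * ρ x i) = A * (b - w) := by
      rw [hb, hw, ← Finset.sum_sub_distrib, Finset.mul_sum]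
      refine Finset.sum_congr rfl fun i _ => ?_
      field_simp
    -- some output distribution in the finite family does at least as well as the average
    obtain ⟨q, hq⟩ : ∃ q : T, ∑ x, P x * d q.1.1 x ≤ t - b + w := by
      by_contra hcon
      push Not at hcon
      have h4 : A * (w - b) ≤ ∑ q : T, μ (Sum.inl q) * (∑ x, P x * d q.1.1 x - t) := by
        rw [hA, Finset.sum_mul]
        refine Finset.sum_le_sum fun q _ => mul_le_mul_of_nonneg_left ?_ (hμ0 _)
        linarith [hcon q]
      rw [h3] at h2
      nlinarith
    have h5 : aInfo α P W ≤ ((t - b + w : ℝ) : EReal) := by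
      refine (iInf₂_le (f := fun (Q : Y → ℝ) (_ : Q ∈ {Q : Y → ℝ | IsPMF Q}) => cDiv α W Q P)
        q.1.1 q.1.2.1).trans ?_
      rw [cDiv_real_aux α hW q.1.2.2 P, EReal.coe_le_coe_iff]
      exact hq
    calc aInfo α P W - (w : EReal) ≤ ((t - b + w : ℝ) : EReal) - (w : EReal) :=
          EReal.sub_le_sub h5 le_rfl
      _ = ((t - b : ℝ) : EReal) := by rw [← EReal.coe_sub]; congr 1; ring
end

section
/- Let W₁ : X₁ → P(Y₁), W₂ : X₂ → P(Y₂) be channels with finite sets, ρᵢ : Xᵢ → ℝ≥0^ℓ cost functions, and for the product channel W(x₁,x₂) = W₁(x₁)⊗W₂(x₂) let ρ(x₁,x₂) := ρ₁(x₁)+ρ₂(x₂). Then for all α ∈ (0,1] and λ ∈ ℝ≥0^ℓ, the A-L capacity is additive: C_α^λ(W) = C_α^λ(W₁) + C_α^λ(W₂). -/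
open scoped BigOperators

namespace ALAux

theorem rSum_nonneg {Y : Type*} [Fintype Y] {α : ℝ} {W Q : Y → ℝ} (hW : IsPMF W) (hQ : IsPMF Q) :
    0 ≤ rSum α W Q :=
  Finset.sum_nonneg fun y _ =>
    mul_nonneg (Real.rpow_nonneg (hW.1 y) _) (Real.rpow_nonneg (hQ.1 y) _)

theorem rSum_le_one {Y : Type*} [Fintype Y] {α : ℝ} (h0 : 0 < α) (h1 : α < 1) {W Q : Y → ℝ}
    (hW : IsPMF W) (hQ : IsPMF Q) : rSum α W Q ≤ 1 := by
  have h : rSum α W Q ≤ ∑ y, (α * W y + (1 - α) * Q y) :=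
    Finset.sum_le_sum fun y _ =>
      Real.geom_mean_le_arith_mean2_weighted h0.le (by linarith) (hW.1 y) (hQ.1 y) (by ring)
  rw [Finset.sum_add_distrib, ← Finset.mul_sum, ← Finset.mul_sum, hW.2, hQ.2] at h
  linarith

theorem log_ge {t : ℝ} (ht : 0 < t) : 1 - 1 / t ≤ Real.log t := by
  have := Real.one_sub_inv_le_log_of_pos ht
  simpa [one_div] using this

theorem dA_nonneg {Y : Type*} [Fintype Y] {α : ℝ} (h0 : 0 < α) (h1 : α ≤ 1) {W Q : Y → ℝ}
    (hW : IsPMF W) (hQ : IsPMF Q) : 0 ≤ dA α W Q := by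
  unfold dA
  split_ifs with h
  · unfold kDiv
    split_ifs with hac
    · rw [EReal.coe_nonneg]
      have hs : ∑ y, (W y - Q y) ≤ ∑ y, if W y = 0 then 0 else W y * Real.log (W y / Q y) := by
        refine Finset.sum_le_sum fun y _ => ?_
        split_ifs with hw
        · have := hQ.1 y; linarith
        · have hwp : 0 < W y := lt_of_le_of_ne (hW.1 y) (Ne.symm hw)
          have hqp : 0 < Q y := lt_of_le_of_ne (hQ.1 y) (fun h => hw (hac y h.symm))
          have := mul_le_mul_of_nonneg_left (log_ge (div_pos hwp hqp)) hwp.le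
          have e : W y * (1 - 1 / (W y / Q y)) = W y - Q y := by field_simp
          linarith
      rw [Finset.sum_sub_distrib, hW.2, hQ.2] at hs
      linarith
    · exact le_top
  · have h1' : α < 1 := lt_of_le_of_ne h1 h
    unfold rDiv
    split_ifs with hr
    · exact le_top
    · rw [EReal.coe_nonneg]
      refine mul_nonneg_of_nonpos_of_nonpos ?_ ?_
      · exact div_nonpos_of_nonneg_of_nonpos zero_le_one (by linarith)
      · exact Real.log_nonpos (rSum_nonneg hW hQ) (rSum_le_one h0 h1' hW hQ)

/-- product -/
def pr {A B : Type*} (f : A → ℝ) (g : B → ℝ) : A × B → ℝ := fun q => f q.1 * g q.2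

theorem pr_pmf {A B : Type*} [Fintype A] [Fintype B] {f : A → ℝ} {g : B → ℝ}
    (hf : IsPMF f) (hg : IsPMF g) : IsPMF (pr f g) := by
  refine ⟨fun q => mul_nonneg (hf.1 _) (hg.1 _), ?_⟩
  simp only [pr]
  rw [Fintype.sum_prod_type]
  simp [← Finset.mul_sum, hf.2, hg.2]

theorem rSum_pr {A B : Type*} [Fintype A] [Fintype B] {α : ℝ} {f Q1 : A → ℝ} {g Q2 : B → ℝ}
    (hf : IsPMF f) (hg : IsPMF g) (h1 : IsPMF Q1) (h2 : IsPMF Q2) :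
    rSum α (pr f g) (pr Q1 Q2) = rSum α f Q1 * rSum α g Q2 := by
  unfold rSum pr
  rw [Fintype.sum_prod_type, Finset.sum_mul_sum]
  refine Finset.sum_congr rfl fun a _ => Finset.sum_congr rfl fun b _ => ?_
  simp only
  rw [Real.mul_rpow (hf.1 a) (hg.1 b), Real.mul_rpow (h1.1 a) (h2.1 b)]
  ring

theorem exists_pos {Y : Type*} [Fintype Y] {W : Y → ℝ} (hW : IsPMF W) : ∃ y, W y ≠ 0 := by
  by_contra! h
  have := hW.2
  simp [h] at this

theorem dA_pr_le {A B : Type*} [Fintype A] [Fintype B] {α : ℝ} (h0 : 0 < α) (h1 : α ≤ 1)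
    {f Q1 : A → ℝ} {g Q2 : B → ℝ}
    (hf : IsPMF f) (hg : IsPMF g) (hQ1 : IsPMF Q1) (hQ2 : IsPMF Q2) :
    dA α (pr f g) (pr Q1 Q2) ≤ dA α f Q1 + dA α g Q2 := by
  have n1 := dA_nonneg h0 h1 hf hQ1
  have n2 := dA_nonneg h0 h1 hg hQ2
  by_cases t1 : dA α f Q1 = ⊤
  · rw [t1, EReal.top_add_of_ne_bot (ne_of_gt (lt_of_lt_of_le EReal.bot_lt_zero n2))]
    exact le_top
  by_cases t2 : dA α g Q2 = ⊤
  · rw [t2, EReal.add_top_of_ne_bot (ne_of_gt (lt_of_lt_of_le EReal.bot_lt_zero n1))]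
    exact le_top
  clear n1 n2
  unfold dA at *
  split_ifs at * with h
  · unfold kDiv at *
    split_ifs at t1 with c1
    swap
    · exact absurd rfl t1
    split_ifs at t2 with c2
    swap
    · exact absurd rfl t2
    have c3 : ∀ y, pr Q1 Q2 y = 0 → pr f g y = 0 := by
      intro y hy
      rcases mul_eq_zero.1 hy with h | h
      · simp [pr, c1 _ h]
      · simp [pr, c2 _ h]
    rw [if_pos c1, if_pos c2, if_pos c3, ← EReal.coe_add, EReal.coe_le_coe_iff]
    apply le_of_eq
    have e : ∀ a b, (if pr f g (a, b) = 0 then 0 else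
        pr f g (a, b) * Real.log (pr f g (a, b) / pr Q1 Q2 (a, b)))
        = g b * (if f a = 0 then 0 else f a * Real.log (f a / Q1 a))
          + f a * (if g b = 0 then 0 else g b * Real.log (g b / Q2 b)) := by
      intro a b
      by_cases ha : f a = 0
      · simp [pr, ha]
      by_cases hb : g b = 0
      · simp [pr, hb]
      have qa : Q1 a ≠ 0 := fun h => ha (c1 _ h)
      have qb : Q2 b ≠ 0 := fun h => hb (c2 _ h)
      simp only [pr, mul_eq_zero, ha, hb, or_self, if_false]
      rw [mul_div_mul_comm, Real.log_mul (div_ne_zero ha qa) (div_ne_zero hb qb)]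
      ring
    rw [Fintype.sum_prod_type]
    simp only [e, Finset.sum_add_distrib]
    simp only [← Finset.mul_sum, ← Finset.sum_mul, hf.2, hg.2, one_mul]
  · unfold rDiv at *
    split_ifs at t1 with c1
    · exact absurd rfl t1
    split_ifs at t2 with c2
    · exact absurd rfl t2
    rw [rSum_pr hf hg hQ1 hQ2, if_neg c1, if_neg c2, if_neg (mul_ne_zero c1 c2),
      ← EReal.coe_add, EReal.coe_le_coe_iff, Real.log_mul c1 c2]
    apply le_of_eq
    ring

/-- first marginal -/
def mg1 {A B : Type*} [Fintype B] (Q : A × B → ℝ) : A → ℝ := fun a => ∑ b, Q (a, b)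
/-- second marginal -/
def mg2 {A B : Type*} [Fintype A] (Q : A × B → ℝ) : B → ℝ := fun b => ∑ a, Q (a, b)

theorem mg1_pmf {A B : Type*} [Fintype A] [Fintype B] {Q : A × B → ℝ} (hQ : IsPMF Q) :
    IsPMF (mg1 Q) := by
  refine ⟨fun a => Finset.sum_nonneg fun b _ => hQ.1 _, ?_⟩
  rw [← hQ.2, Fintype.sum_prod_type]; rfl

theorem mg2_pmf {A B : Type*} [Fintype A] [Fintype B] {Q : A × B → ℝ} (hQ : IsPMF Q) :
    IsPMF (mg2 Q) := by
  refine ⟨fun a => Finset.sum_nonneg fun b _ => hQ.1 _, ?_⟩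
  rw [← hQ.2, Fintype.sum_prod_type_right]; rfl

theorem mg1_zero {A B : Type*} [Fintype A] [Fintype B] {Q : A × B → ℝ} (hQ : IsPMF Q) {a : A}
    (h : mg1 Q a = 0) (b : B) : Q (a, b) = 0 :=
  (Finset.sum_eq_zero_iff_of_nonneg (fun b _ => hQ.1 (a, b))).1 h b (Finset.mem_univ _)

/-- averaged conditional -/
noncomputable def avg {A B : Type*} [Fintype A] [Fintype B] (Q : A × B → ℝ) (V : A → ℝ) : B → ℝ :=
  fun b => ∑ a, V a * (Q (a, b) / mg1 Q a)

theorem avg_pmf {A B : Type*} [Fintype A] [Fintype B] {Q : A × B → ℝ} (hQ : IsPMF Q) {V : A → ℝ}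
    (hV : IsPMF V) (hac : ∀ a, mg1 Q a = 0 → V a = 0) : IsPMF (avg Q V) := by
  refine ⟨fun b => Finset.sum_nonneg fun a _ =>
    mul_nonneg (hV.1 a) (div_nonneg (hQ.1 _) ((mg1_pmf hQ).1 a)), ?_⟩
  unfold avg
  rw [Finset.sum_comm, ← hV.2]
  refine Finset.sum_congr rfl fun a _ => ?_
  rw [← Finset.mul_sum, ← Finset.sum_div]
  change V a * (mg1 Q a / mg1 Q a) = V a
  by_cases h : mg1 Q a = 0
  · simp [hac a h]
  · rw [div_self h, mul_one]

theorem key_one {A B : Type*} [Fintype A] [Fintype B]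
    {Q : A × B → ℝ} (hQ : IsPMF Q) {f : A → ℝ} (hf : IsPMF f) :
    ∃ Q' : B → ℝ, IsPMF Q' ∧ ∀ g : B → ℝ, IsPMF g →
      kDiv f (mg1 Q) + kDiv g Q' ≤ kDiv (pr f g) Q := by
  by_cases hac : ∀ a, mg1 Q a = 0 → f a = 0
  swap
  · refine ⟨mg2 Q, mg2_pmf hQ, fun g hg => ?_⟩
    have : ¬ ∀ y, Q y = 0 → pr f g y = 0 := by
      intro h
      push Not at hac
      obtain ⟨a, ha, hfa⟩ := hac
      obtain ⟨b, hb⟩ := exists_pos hg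
      exact mul_ne_zero hfa hb (h (a, b) (mg1_zero hQ ha b))
    rw [show kDiv (pr f g) Q = ⊤ by unfold kDiv; rw [if_neg this]]
    exact le_top
  refine ⟨avg Q f, avg_pmf hQ hf hac, fun g hg => ?_⟩
  have hQ' := avg_pmf hQ hf hac
  by_cases c3 : ∀ y, Q y = 0 → pr f g y = 0
  swap
  · rw [show kDiv (pr f g) Q = ⊤ by unfold kDiv; rw [if_neg c3]]
    exact le_top
  have c2 : ∀ b, avg Q f b = 0 → g b = 0 := by
    intro b hb
    obtain ⟨a, ha⟩ := exists_pos hf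
    have h1 := (Finset.sum_eq_zero_iff_of_nonneg (fun a _ =>
      mul_nonneg (hf.1 a) (div_nonneg (hQ.1 (a, b)) ((mg1_pmf hQ).1 a)))).1 hb a (Finset.mem_univ _)
    have hm : mg1 Q a ≠ 0 := fun h => ha (hac a h)
    have hq : Q (a, b) = 0 := by
      rcases mul_eq_zero.1 h1 with h | h
      · exact absurd h ha
      · rcases div_eq_zero_iff.1 h with h | h
        · exact h
        · exact absurd h hm
    rcases mul_eq_zero.1 (c3 _ hq) with h | h
    · exact absurd h ha
    · exact h
  unfold kDiv
  rw [if_pos hac, if_pos c2, if_pos c3, ← EReal.coe_add, EReal.coe_le_coe_iff]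
  have e : ∀ a b, g b * (if f a = 0 then 0 else f a * Real.log (f a / mg1 Q a))
          + f a * (if g b = 0 then 0 else g b * Real.log (g b / avg Q f b))
          + (f a * g b - (g b / avg Q f b) * (f a * (Q (a, b) / mg1 Q a))) ≤
        (if pr f g (a, b) = 0 then 0 else
        pr f g (a, b) * Real.log (pr f g (a, b) / Q (a, b))) := by
    intro a b
    by_cases ha : f a = 0
    · simp [pr, ha]
    by_cases hb : g b = 0
    · simp [pr, hb]
    have hfp := lt_of_le_of_ne (hf.1 a) (Ne.symm ha)
    have hgp := lt_of_le_of_ne (hg.1 b) (Ne.symm hb)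
    have qa : 0 < mg1 Q a := lt_of_le_of_ne ((mg1_pmf hQ).1 a) (fun h => ha (hac _ h.symm))
    have qb : 0 < avg Q f b := lt_of_le_of_ne (hQ'.1 b) (fun h => hb (c2 _ h.symm))
    have qq : 0 < Q (a, b) := lt_of_le_of_ne (hQ.1 _)
      (fun h => mul_ne_zero ha hb (c3 (a, b) h.symm))
    simp only [pr, mul_eq_zero, ha, hb, or_self, if_false]
    have hl := mul_le_mul_of_nonneg_left
      (log_ge (div_pos (mul_pos qa qb) qq)) (mul_pos hfp hgp).le
    rw [Real.log_div (mul_pos qa qb).ne' qq.ne', Real.log_mul qa.ne' qb.ne'] at hl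
    rw [Real.log_div ha qa.ne', Real.log_div hb qb.ne',
      Real.log_div (mul_pos hfp hgp).ne' qq.ne', Real.log_mul ha hb]
    have e2 : f a * g b * (1 - 1 / (mg1 Q a * avg Q f b / Q (a, b)))
      = (f a * g b - (g b / avg Q f b) * (f a * (Q (a, b) / mg1 Q a))) := by
      field_simp
    rw [← e2]
    linarith
  have hs := Finset.sum_le_sum (s := Finset.univ) fun a _ =>
    Finset.sum_le_sum (s := Finset.univ) fun b _ => e a b
  rw [Fintype.sum_prod_type]
  refine le_trans ?_ hs
  simp only [Finset.sum_add_distrib, Finset.sum_sub_distrib]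
  rw [Finset.sum_comm (f := fun a b => g b / avg Q f b * (f a * (Q (a, b) / mg1 Q a)))]
  simp only [← Finset.mul_sum, ← Finset.sum_mul, hf.2, hg.2, one_mul]
  have : ∑ b, g b / avg Q f b * ∑ a, f a * (Q (a, b) / mg1 Q a) ≤ ∑ b, g b := by
    refine Finset.sum_le_sum fun b _ => ?_
    change g b / avg Q f b * avg Q f b ≤ g b
    by_cases h : avg Q f b = 0
    · rw [h, mul_zero]; exact hg.1 b
    · rw [div_mul_cancel₀ _ h]
  rw [hg.2] at this
  linarith

theorem key_lt {A B : Type*} [Fintype A] [Fintype B] {α : ℝ} (h0 : 0 < α) (h1 : α < 1)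
    {Q : A × B → ℝ} (hQ : IsPMF Q) {f : A → ℝ} (hf : IsPMF f) :
    ∃ Q' : B → ℝ, IsPMF Q' ∧ ∀ g : B → ℝ, IsPMF g →
      rDiv α f (mg1 Q) + rDiv α g Q' ≤ rDiv α (pr f g) Q := by
  have hm := mg1_pmf hQ
  have hα : (1 - α) ≠ 0 := by linarith
  by_cases hr : rSum α f (mg1 Q) = 0
  · refine ⟨mg2 Q, mg2_pmf hQ, fun g hg => ?_⟩
    have : rSum α (pr f g) Q = 0 := by
      unfold rSum at *
      rw [Fintype.sum_prod_type]
      refine Finset.sum_eq_zero fun a _ => Finset.sum_eq_zero fun b _ => ?_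
      have h := (Finset.sum_eq_zero_iff_of_nonneg (fun a _ => mul_nonneg
        (Real.rpow_nonneg (hf.1 a) _) (Real.rpow_nonneg (hm.1 a) _))).1 hr a (Finset.mem_univ _)
      rcases mul_eq_zero.1 h with h | h
      · rw [Real.rpow_eq_zero (hf.1 a) h0.ne'] at h
        simp [pr, h, Real.zero_rpow h0.ne']
      · rw [Real.rpow_eq_zero (hm.1 a) hα] at h
        rw [mg1_zero hQ h b, Real.zero_rpow hα, mul_zero]
    rw [show rDiv α (pr f g) Q = ⊤ by unfold rDiv; rw [if_pos this]]
    exact le_top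
  set r := rSum α f (mg1 Q) with hrdef
  have hrp : 0 < r := lt_of_le_of_ne (rSum_nonneg hf hm) (Ne.symm hr)
  set V : A → ℝ := fun a => f a ^ α * mg1 Q a ^ (1 - α) / r with hVdef
  have hV : IsPMF V := by
    refine ⟨fun a => div_nonneg (mul_nonneg
        (Real.rpow_nonneg (hf.1 a) _) (Real.rpow_nonneg (hm.1 a) _)) hrp.le, ?_⟩
    simp only [hVdef]
    rw [← Finset.sum_div]
    exact div_self hr
  have hac : ∀ a, mg1 Q a = 0 → V a = 0 := by
    intro a ha
    simp [hVdef, ha, Real.zero_rpow hα]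
  have hQ' := avg_pmf hQ hV hac
  refine ⟨avg Q V, hQ', fun g hg => ?_⟩
  by_cases c3 : rSum α (pr f g) Q = 0
  · rw [show rDiv α (pr f g) Q = ⊤ by unfold rDiv; rw [if_pos c3]]
    exact le_top
  have c3p : 0 < rSum α (pr f g) Q := lt_of_le_of_ne (rSum_nonneg (pr_pmf hf hg) hQ) (Ne.symm c3)
  have hle : rSum α (pr f g) Q ≤ r * rSum α g (avg Q V) := by
    have e1 : rSum α (pr f g) Q = r * ∑ b, g b ^ α * ∑ a, V a * (Q (a, b) / mg1 Q a) ^ (1 - α) := by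
      conv_lhs => unfold rSum
      rw [Fintype.sum_prod_type_right, Finset.mul_sum]
      refine Finset.sum_congr rfl fun b _ => ?_
      rw [Finset.mul_sum, Finset.mul_sum]
      refine Finset.sum_congr rfl fun a _ => ?_
      simp only [pr, hVdef]
      rw [Real.mul_rpow (hf.1 a) (hg.1 b)]
      by_cases h : mg1 Q a = 0
      · rw [mg1_zero hQ h b, h, Real.zero_rpow hα]; simp
      · have hmp := lt_of_le_of_ne (hm.1 a) (Ne.symm h)
        rw [Real.div_rpow (hQ.1 _) hmp.le]
        have := (Real.rpow_pos_of_pos hmp (1 - α)).ne'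
        field_simp
    rw [e1]
    refine mul_le_mul_of_nonneg_left ?_ hrp.le
    refine Finset.sum_le_sum fun b _ => mul_le_mul_of_nonneg_left ?_ (Real.rpow_nonneg (hg.1 b) _)
    have := (Real.concaveOn_rpow (p := 1 - α) (by linarith) (by linarith)).le_map_sum
      (t := Finset.univ) (w := V) (p := fun a => Q (a, b) / mg1 Q a) (fun a _ => hV.1 a) hV.2
      (fun a _ => div_nonneg (hQ.1 _) (hm.1 a))
    simpa only [smul_eq_mul, avg] using this
  have hr2 : 0 < rSum α g (avg Q V) := by
    by_contra! h
    have := mul_nonpos_of_nonneg_of_nonpos hrp.le h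
    linarith
  unfold rDiv
  rw [if_neg hr, if_neg c3, if_neg hr2.ne', ← EReal.coe_add, EReal.coe_le_coe_iff, ← mul_add,
    ← Real.log_mul hr hr2.ne']
  refine mul_le_mul_of_nonpos_left (Real.log_le_log c3p hle) ?_
  exact div_nonpos_of_nonneg_of_nonpos zero_le_one (by linarith)

theorem key {A B : Type*} [Fintype A] [Fintype B] {α : ℝ} (h0 : 0 < α) (h1 : α ≤ 1)
    {Q : A × B → ℝ} (hQ : IsPMF Q) {f : A → ℝ} (hf : IsPMF f) :
    ∃ Q' : B → ℝ, IsPMF Q' ∧ ∀ g : B → ℝ, IsPMF g →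
      dA α f (mg1 Q) + dA α g Q' ≤ dA α (pr f g) Q := by
  unfold dA
  split_ifs with h
  · exact key_one hQ hf
  · exact key_lt h0 (lt_of_le_of_ne h1 h) hQ hf

open scoped ENNReal

/-- divergence in ENNReal -/
noncomputable def dN {Y : Type*} [Fintype Y] (α : ℝ) (W Q : Y → ℝ) : ℝ≥0∞ := (dA α W Q).toENNReal

/-- conditional divergence -/
noncomputable def cN {X Y : Type*} [Fintype X] [Fintype Y]
    (α : ℝ) (W : X → Y → ℝ) (Q : Y → ℝ) (P : X → ℝ) : ℝ≥0∞ :=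
  ∑ x, ENNReal.ofReal (P x) * dN α (W x) Q

/-- information -/
noncomputable def iN {X Y : Type*} [Fintype X] [Fintype Y]
    (α : ℝ) (P : X → ℝ) (W : X → Y → ℝ) : ℝ≥0∞ :=
  ⨅ Q : {Q : Y → ℝ // IsPMF Q}, cN α W Q.1 P

theorem coe_sum {X : Type*} (s : Finset X) (f : X → ℝ≥0∞) :
    ((∑ x ∈ s, f x : ℝ≥0∞) : EReal) = ∑ x ∈ s, (f x : EReal) := by
  classical
  induction s using Finset.induction_on with
  | empty => simp
  | insert a s ha ih => rw [Finset.sum_insert ha, Finset.sum_insert ha, EReal.coe_ennreal_add, ih]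

theorem cDiv_eq {X Y : Type*} [Fintype X] [Fintype Y] {α : ℝ} (h0 : 0 < α) (h1 : α ≤ 1)
    {W : X → Y → ℝ} (hW : ∀ x, IsPMF (W x)) {Q : Y → ℝ} (hQ : IsPMF Q) {P : X → ℝ} (hP : IsPMF P) :
    cDiv α W Q P = (cN α W Q P : EReal) := by
  unfold cDiv cN dN
  rw [coe_sum]
  refine Finset.sum_congr rfl fun x _ => ?_
  rw [EReal.coe_ennreal_mul, EReal.coe_toENNReal (dA_nonneg h0 h1 (hW x) hQ),
    EReal.coe_ennreal_ofReal, max_eq_left (hP.1 x)]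

theorem aInfo_eq {X Y : Type*} [Fintype X] [Fintype Y] {α : ℝ} (h0 : 0 < α) (h1 : α ≤ 1)
    {W : X → Y → ℝ} (hW : ∀ x, IsPMF (W x)) {P : X → ℝ} (hP : IsPMF P) :
    aInfo α P W = (iN α P W : EReal) := by
  have hnn : 0 ≤ aInfo α P W := by
    refine le_iInf₂ fun Q hQ => ?_
    rw [cDiv_eq h0 h1 hW hQ hP]
    exact EReal.coe_ennreal_nonneg _
  apply le_antisymm
  · rw [← EReal.coe_toENNReal hnn, EReal.coe_ennreal_le_coe_ennreal_iff]
    refine le_iInf fun Q => ?_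
    rw [← EReal.coe_ennreal_le_coe_ennreal_iff, EReal.coe_toENNReal hnn,
      ← cDiv_eq h0 h1 hW Q.2 hP]
    exact iInf₂_le Q.1 Q.2
  · refine le_iInf₂ fun Q hQ => ?_
    rw [cDiv_eq h0 h1 hW hQ hP, EReal.coe_ennreal_le_coe_ennreal_iff]
    exact iInf_le (fun Q : {Q : Y → ℝ // IsPMF Q} => cN α W Q.1 P) ⟨Q, hQ⟩

theorem sum_ofReal {X : Type*} [Fintype X] {P : X → ℝ} (hP : IsPMF P) :
    ∑ x, ENNReal.ofReal (P x) = 1 := by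
  rw [← ENNReal.ofReal_sum_of_nonneg (fun x _ => hP.1 x), hP.2, ENNReal.ofReal_one]

theorem dN_pr_le {A B : Type*} [Fintype A] [Fintype B] {α : ℝ} (h0 : 0 < α) (h1 : α ≤ 1)
    {f Q1 : A → ℝ} {g Q2 : B → ℝ}
    (hf : IsPMF f) (hg : IsPMF g) (hQ1 : IsPMF Q1) (hQ2 : IsPMF Q2) :
    dN α (pr f g) (pr Q1 Q2) ≤ dN α f Q1 + dN α g Q2 := by
  unfold dN
  rw [← EReal.toENNReal_add (dA_nonneg h0 h1 hf hQ1) (dA_nonneg h0 h1 hg hQ2)]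
  exact EReal.toENNReal_le_toENNReal (dA_pr_le h0 h1 hf hg hQ1 hQ2)

theorem keyN {A B : Type*} [Fintype A] [Fintype B] {α : ℝ} (h0 : 0 < α) (h1 : α ≤ 1)
    {Q : A × B → ℝ} (hQ : IsPMF Q) {f : A → ℝ} (hf : IsPMF f) :
    ∃ Q' : B → ℝ, IsPMF Q' ∧ ∀ g : B → ℝ, IsPMF g →
      dN α f (mg1 Q) + dN α g Q' ≤ dN α (pr f g) Q := by
  obtain ⟨Q', hQ', h⟩ := key h0 h1 hQ hf
  refine ⟨Q', hQ', fun g hg => ?_⟩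
  unfold dN
  rw [← EReal.toENNReal_add (dA_nonneg h0 h1 hf (mg1_pmf hQ)) (dA_nonneg h0 h1 hg hQ')]
  exact EReal.toENNReal_le_toENNReal (h g hg)

section
variable {X₁ X₂ Y₁ Y₂ : Type*} [Fintype X₁] [Fintype X₂] [Fintype Y₁] [Fintype Y₂]

theorem iN_sub {α : ℝ} (h0 : 0 < α) (h1 : α ≤ 1)
    {W₁ : X₁ → Y₁ → ℝ} (hW₁ : ∀ x, IsPMF (W₁ x))
    {W₂ : X₂ → Y₂ → ℝ} (hW₂ : ∀ x, IsPMF (W₂ x)) {P : X₁ × X₂ → ℝ} (hP : IsPMF P) :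
    iN α P (fun p => pr (W₁ p.1) (W₂ p.2)) ≤ iN α (mg1 P) W₁ + iN α (mg2 P) W₂ := by
  unfold iN
  rw [ENNReal.iInf_add]
  refine le_iInf fun Q1 => ?_
  rw [ENNReal.add_iInf]
  refine le_iInf fun Q2 => ?_
  refine (iInf_le _ ⟨pr Q1.1 Q2.1, pr_pmf Q1.2 Q2.2⟩).trans ?_
  unfold cN
  calc _ ≤ ∑ x : X₁ × X₂, (ENNReal.ofReal (P x) * dN α (W₁ x.1) Q1.1
            + ENNReal.ofReal (P x) * dN α (W₂ x.2) Q2.1) := by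
          refine Finset.sum_le_sum fun x _ => ?_
          rw [← mul_add]
          exact mul_le_mul_right (dN_pr_le h0 h1 (hW₁ _) (hW₂ _) Q1.2 Q2.2) _
    _ ≤ _ := by
          rw [Finset.sum_add_distrib]
          apply le_of_eq
          congr 1
          · rw [Fintype.sum_prod_type]
            refine Finset.sum_congr rfl fun a _ => ?_
            dsimp only
            rw [← Finset.sum_mul, ← ENNReal.ofReal_sum_of_nonneg (fun x _ => hP.1 _)]
            rfl
          · rw [Fintype.sum_prod_type_right]
            refine Finset.sum_congr rfl fun a _ => ?_
            dsimp only
            rw [← Finset.sum_mul, ← ENNReal.ofReal_sum_of_nonneg (fun x _ => hP.1 _)]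
            rfl

theorem iN_super {α : ℝ} (h0 : 0 < α) (h1 : α ≤ 1)
    {W₁ : X₁ → Y₁ → ℝ} (hW₁ : ∀ x, IsPMF (W₁ x))
    {W₂ : X₂ → Y₂ → ℝ} (hW₂ : ∀ x, IsPMF (W₂ x)) {P₁ : X₁ → ℝ} (hP₁ : IsPMF P₁)
    {P₂ : X₂ → ℝ} (hP₂ : IsPMF P₂) :
    iN α P₁ W₁ + iN α P₂ W₂ ≤ iN α (pr P₁ P₂) (fun p => pr (W₁ p.1) (W₂ p.2)) := by
  conv_rhs => unfold iN
  refine le_iInf fun Q => ?_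
  choose Q' hQ' hk using fun x => keyN h0 h1 Q.2 (hW₁ x)
  calc iN α P₁ W₁ + iN α P₂ W₂ ≤ cN α W₁ (mg1 Q.1) P₁ + iN α P₂ W₂ := by
        gcongr
        exact iInf_le (fun Q : {Q : Y₁ → ℝ // IsPMF Q} => cN α W₁ Q.1 P₁) ⟨_, mg1_pmf Q.2⟩
    _ = ∑ x, ENNReal.ofReal (P₁ x) * (dN α (W₁ x) (mg1 Q.1) + iN α P₂ W₂) := by
        simp only [mul_add, Finset.sum_add_distrib]
        rw [← Finset.sum_mul, sum_ofReal hP₁, one_mul]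
        rfl
    _ ≤ ∑ x, ENNReal.ofReal (P₁ x) * (dN α (W₁ x) (mg1 Q.1) + cN α W₂ (Q' x) P₂) := by
        gcongr with x
        exact iInf_le (fun Q : {Q : Y₂ → ℝ // IsPMF Q} => cN α W₂ Q.1 P₂) ⟨_, hQ' x⟩
    _ = ∑ x, ENNReal.ofReal (P₁ x) * ∑ z, ENNReal.ofReal (P₂ z) *
          (dN α (W₁ x) (mg1 Q.1) + dN α (W₂ z) (Q' x)) := by
        refine Finset.sum_congr rfl fun x _ => ?_
        simp only [mul_add, Finset.sum_add_distrib]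
        rw [← Finset.sum_mul, sum_ofReal hP₂, one_mul]
        rfl
    _ ≤ ∑ x, ENNReal.ofReal (P₁ x) * ∑ z, ENNReal.ofReal (P₂ z) *
          dN α (pr (W₁ x) (W₂ z)) Q.1 := by
        gcongr with x _ z
        exact hk x _ (hW₂ z)
    _ = _ := by
        unfold cN
        rw [Fintype.sum_prod_type]
        refine Finset.sum_congr rfl fun x _ => ?_
        rw [Finset.mul_sum]
        refine Finset.sum_congr rfl fun z _ => ?_
        rw [← mul_assoc, ← ENNReal.ofReal_mul (hP₁.1 x)]
        rfl

theorem cost_eq {l : ℕ} (ρ₁ : X₁ → Fin l → ℝ) (ρ₂ : X₂ → Fin l → ℝ) (lam : Fin l → ℝ)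
    (P : X₁ × X₂ → ℝ) :
    ∑ i, lam i * ∑ x, P x * (ρ₁ x.1 i + ρ₂ x.2 i) =
      (∑ i, lam i * ∑ x, mg1 P x * ρ₁ x i) + ∑ i, lam i * ∑ x, mg2 P x * ρ₂ x i := by
  rw [← Finset.sum_add_distrib]
  refine Finset.sum_congr rfl fun i _ => ?_
  rw [← mul_add]
  congr 1
  simp only [mul_add, Finset.sum_add_distrib]
  congr 1
  · rw [Fintype.sum_prod_type]
    simp only [mg1, Finset.sum_mul]
  · rw [Fintype.sum_prod_type_right]
    simp only [mg2, Finset.sum_mul]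

theorem mg1_pr {P₁ : X₁ → ℝ} {P₂ : X₂ → ℝ} (hP₂ : IsPMF P₂) : mg1 (pr P₁ P₂) = P₁ := by
  funext a
  simp [mg1, pr, ← Finset.mul_sum, hP₂.2]

theorem mg2_pr {P₁ : X₁ → ℝ} {P₂ : X₂ → ℝ} (hP₁ : IsPMF P₁) : mg2 (pr P₁ P₂) = P₂ := by
  funext a
  simp [mg2, pr, ← Finset.sum_mul, hP₁.2]

theorem sub_split (a b : EReal) (c d : ℝ) :
    a + b - ((c + d : ℝ) : EReal) = (a - (c : EReal)) + (b - (d : EReal)) := by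
  rw [sub_eq_add_neg, sub_eq_add_neg, sub_eq_add_neg, ← EReal.coe_neg, ← EReal.coe_neg,
    ← EReal.coe_neg, neg_add, EReal.coe_add, add_add_add_comm]

end

end ALAux

/-- additivity of the A-L capacity for product channels with additive costs. -/
theorem alCap_additive {X₁ X₂ Y₁ Y₂ : Type*}
    [Fintype X₁] [Fintype X₂] [Fintype Y₁] [Fintype Y₂]
    [Nonempty X₁] [Nonempty X₂] [Nonempty Y₁] [Nonempty Y₂] {l : ℕ} (hl : 0 < l)
    (α : ℝ) (hα : α ∈ Set.Ioc (0 : ℝ) 1)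
    (W₁ : X₁ → Y₁ → ℝ) (hW₁ : ∀ x, IsPMF (W₁ x))
    (W₂ : X₂ → Y₂ → ℝ) (hW₂ : ∀ x, IsPMF (W₂ x))
    (ρ₁ : X₁ → Fin l → ℝ) (hρ₁ : ∀ x i, 0 ≤ ρ₁ x i)
    (ρ₂ : X₂ → Fin l → ℝ) (hρ₂ : ∀ x i, 0 ≤ ρ₂ x i)
    (lam : Fin l → ℝ) (hlam : ∀ i, 0 ≤ lam i) :
    alCap α (fun p : X₁ × X₂ => fun q : Y₁ × Y₂ => W₁ p.1 q.1 * W₂ p.2 q.2)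
        (fun p i => ρ₁ p.1 i + ρ₂ p.2 i) lam =
      alCap α W₁ ρ₁ lam + alCap α W₂ ρ₂ lam := by
  obtain ⟨h0, h1⟩ := hα
  have hW : ∀ p : X₁ × X₂, IsPMF (ALAux.pr (W₁ p.1) (W₂ p.2)) :=
    fun p => ALAux.pr_pmf (hW₁ _) (hW₂ _)
  change alCap α (fun p : X₁ × X₂ => ALAux.pr (W₁ p.1) (W₂ p.2)) _ lam = _
  apply le_antisymm
  · refine iSup₂_le fun P hP => ?_
    have hP : IsPMF P := hP
    rw [ALAux.aInfo_eq h0 h1 hW hP, ALAux.cost_eq]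
    have hs : ((ALAux.iN α P (fun p : X₁ × X₂ => ALAux.pr (W₁ p.1) (W₂ p.2)) : ENNReal) : EReal) ≤
        aInfo α (ALAux.mg1 P) W₁ + aInfo α (ALAux.mg2 P) W₂ := by
      rw [ALAux.aInfo_eq h0 h1 hW₁ (ALAux.mg1_pmf hP), ALAux.aInfo_eq h0 h1 hW₂ (ALAux.mg2_pmf hP),
        ← EReal.coe_ennreal_add, EReal.coe_ennreal_le_coe_ennreal_iff]
      exact ALAux.iN_sub h0 h1 hW₁ hW₂ hP
    refine (EReal.sub_le_sub hs le_rfl).trans ?_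
    rw [ALAux.sub_split]
    exact add_le_add
      (le_iSup₂_of_le (ALAux.mg1 P) (ALAux.mg1_pmf hP) le_rfl)
      (le_iSup₂_of_le (ALAux.mg2 P) (ALAux.mg2_pmf hP) le_rfl)
  · refine EReal.add_le_of_forall_lt fun a ha b hb => ?_
    obtain ⟨P₁, ha⟩ := lt_iSup_iff.1 ha
    obtain ⟨hP₁, ha⟩ := lt_iSup_iff.1 ha
    obtain ⟨P₂, hb⟩ := lt_iSup_iff.1 hb
    obtain ⟨hP₂, hb⟩ := lt_iSup_iff.1 hb
    have hP₁ : IsPMF P₁ := hP₁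
    have hP₂ : IsPMF P₂ := hP₂
    refine (add_le_add ha.le hb.le).trans ?_
    refine le_iSup₂_of_le (ALAux.pr P₁ P₂) (ALAux.pr_pmf hP₁ hP₂) ?_
    rw [ALAux.cost_eq, ALAux.mg1_pr hP₂, ALAux.mg2_pr hP₁, ← ALAux.sub_split]
    refine EReal.sub_le_sub ?_ le_rfl
    rw [ALAux.aInfo_eq h0 h1 hW₁ hP₁, ALAux.aInfo_eq h0 h1 hW₂ hP₂,
      ALAux.aInfo_eq h0 h1 hW (ALAux.pr_pmf hP₁ hP₂),
        ← EReal.coe_ennreal_add, EReal.coe_ennreal_le_coe_ennreal_iff]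
    exact ALAux.iN_super h0 h1 hW₁ hW₂ hP₁ hP₂
end

section
/- Let W : X → P(Y) with X, Y finite, α ∈ (0,1], C a nonempty convex set of probability mass functions on X with finite Augustin capacity, Q_C the Augustin center (the minimizer of inf_Q sup_{P∈C} Σ_x P(x)D_α(W(x)‖Q)), and P ∈ C with Augustin mean Q_{α,P} (the minimizer of inf_Q Σ_x P(x)D_α(W(x)‖Q)). Then C_α(W,C) − I_α(P;W) ≥ D_α(Q_{α,P} ‖ Q_C). -/
open scoped BigOperators

namespace AugAux
open Finset

lemma rSum_nonneg {Y : Type*} [Fintype Y] {α : ℝ} {W Q : Y → ℝ} (hW : ∀ y, 0 ≤ W y)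
    (hQ : ∀ y, 0 ≤ Q y) : 0 ≤ rSum α W Q :=
  Finset.sum_nonneg fun y _ => mul_nonneg (Real.rpow_nonneg (hW y) _) (Real.rpow_nonneg (hQ y) _)

lemma rpow_gap {α q t : ℝ} (h0 : 0 < α) (h1 : α < 1) (hq : 0 ≤ q) (ht : 0 < t) :
    (1 - α) * t / (q + t) ^ α ≤ (q + t) ^ (1 - α) - q ^ (1 - α) := by
  have hqt : 0 < q + t := by linarith
  have hb := rpow_one_add_le_one_add_mul_self (s := -t / (q + t))
    (by rw [neg_div, neg_le_neg_iff, div_le_one hqt]; linarith) (p := 1 - α) (by linarith) (by linarith)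
  have e1 : 1 + -t / (q + t) = q / (q + t) := by field_simp; ring
  rw [e1, Real.div_rpow hq hqt.le] at hb
  have hp : 0 < (q + t) ^ (1 - α) := Real.rpow_pos_of_pos hqt _
  rw [div_le_iff₀ hp] at hb
  have e2 : (q + t) ^ (1 - α) = (q + t) / (q + t) ^ α := by
    rw [Real.rpow_sub hqt, Real.rpow_one]
  have hpa : 0 < (q + t) ^ α := Real.rpow_pos_of_pos hqt _
  have e3 : (1 + (1 - α) * (-t / (q + t))) * (q + t) ^ (1 - α)
      = (q + t) ^ (1 - α) - (1 - α) * t / (q + t) ^ α := by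
    rw [e2]; field_simp; ring
  linarith

lemma log_lower {a A B : ℝ} (ha : 0 ≤ a) (hA : 0 < A) (hB : 0 ≤ B) {M k : ℝ} (haM : a ≤ M)
    (hk : B / A ≤ k) : a * B / (A + M * B) ≤ Real.log (1 + a * k) := by
  have hk0 : 0 ≤ B / A := by positivity
  have h1 : 0 < 1 + a * (B / A) := by positivity
  have h2 := Real.one_sub_inv_le_log_of_pos h1
  have h3 : Real.log (1 + a * (B / A)) ≤ Real.log (1 + a * k) := by
    apply Real.log_le_log h1
    gcongr
  have h4 : 1 - (1 + a * (B / A))⁻¹ = a * B / (A + a * B) := by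
    have : A + a * B ≠ 0 := by positivity
    have : 1 + a * (B / A) = (A + a * B) / A := by field_simp
    rw [this]; field_simp; ring
  have h5 : a * B / (A + M * B) ≤ a * B / (A + a * B) := by
    gcongr
  linarith

lemma kkt {X Y : Type*} [Fintype X] [Fintype Y] {α : ℝ} (h0 : 0 < α) (h1 : α < 1)
    {W : X → Y → ℝ} (hW : ∀ x, IsPMF (W x)) {P : X → ℝ} (hP : IsPMF P) {Q : Y → ℝ}
    (hQ : IsPMF Q) (hS : ∀ x, P x ≠ 0 → 0 < rSum α (W x) Q)
    (hmin : ∀ Q', IsPMF Q' → (∀ x, P x ≠ 0 → 0 < rSum α (W x) Q') →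
      ∑ x, P x * Real.log (rSum α (W x) Q') ≤ ∑ x, P x * Real.log (rSum α (W x) Q)) (y0 : Y) :
    ∑ x, P x * (W x y0 ^ α / rSum α (W x) Q) ≤ Q y0 ^ α := by
  classical
  set a : X → ℝ := fun x => W x y0 ^ α / rSum α (W x) Q with ha
  have ha0 : ∀ x, 0 ≤ a x := fun x =>
    div_nonneg (Real.rpow_nonneg ((hW x).1 _) _) (rSum_nonneg (hW x).1 hQ.1)
  set M := ∑ x, a x with hM
  have haM : ∀ x, a x ≤ M := fun x => Finset.single_le_sum (fun i _ => ha0 i) (Finset.mem_univ x)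
  have hM0 : 0 ≤ M := Finset.sum_nonneg fun i _ => ha0 i
  have q0 := hQ.1 y0
  have key : ∀ t : ℝ, 0 < t →
      ∑ x, P x * a x ≤ (Q y0 + t) ^ α + M * ((1 - α) * t) := by
    intro t ht
    have ht1 : 0 < 1 + t := by linarith
    set k := (Q y0 + t) ^ (1 - α) - Q y0 ^ (1 - α) with hk
    have hgap := rpow_gap h0 h1 q0 ht
    have hA : 0 < (Q y0 + t) ^ α := Real.rpow_pos_of_pos (by linarith) _
    have hB : 0 < (1 - α) * t := mul_pos (by linarith) ht
    have hk0 : 0 ≤ k := le_trans (by positivity) hgap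
    set Q' : Y → ℝ := fun y => (Q y + if y = y0 then t else 0) / (1 + t) with hQ'
    have hnn : ∀ y, 0 ≤ Q y + if y = y0 then t else 0 := fun y => by
      have := hQ.1 y
      split_ifs <;> linarith
    have hQ'p : IsPMF Q' := by
      refine ⟨fun y => div_nonneg (hnn y) ht1.le, ?_⟩
      rw [hQ', ← Finset.sum_div, Finset.sum_add_distrib, hQ.2]
      simp [ht1.ne']
    have hS' : ∀ x, rSum α (W x) Q' =
        (rSum α (W x) Q + W x y0 ^ α * k) / (1 + t) ^ (1 - α) := by
      intro x
      have : ∀ y, W x y ^ α * Q' y ^ (1 - α) =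
          (W x y ^ α * Q y ^ (1 - α) + if y = y0 then W x y0 ^ α * k else 0)
            / (1 + t) ^ (1 - α) := by
        intro y
        rw [hQ']
        simp only
        rw [Real.div_rpow (hnn y) ht1.le]
        by_cases h : y = y0
        · subst h; simp only [if_true, hk]; ring
        · simp [h]; ring
      unfold rSum
      rw [Finset.sum_congr rfl fun y _ => this y, ← Finset.sum_div, Finset.sum_add_distrib]
      simp
    have hpt : 0 < (1 + t) ^ (1 - α) := Real.rpow_pos_of_pos ht1 _
    have hW0 : ∀ x, 0 ≤ W x y0 ^ α := fun x => Real.rpow_nonneg ((hW x).1 _) _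
    have hpos : ∀ x, P x ≠ 0 → 0 < rSum α (W x) Q' := by
      intro x hx
      rw [hS' x]
      have := hS x hx
      have := mul_nonneg (hW0 x) hk0
      positivity
    have hm := hmin Q' hQ'p hpos
    have hterm : ∀ x, P x * Real.log (rSum α (W x) Q') =
        P x * Real.log (rSum α (W x) Q) + P x * Real.log (1 + a x * k)
          - P x * ((1 - α) * Real.log (1 + t)) := by
      intro x
      by_cases hx : P x = 0
      · simp [hx]
      have hs := hS x hx
      have hz : 0 < 1 + a x * k := by have := mul_nonneg (ha0 x) hk0; linarith
      have : rSum α (W x) Q' = rSum α (W x) Q * (1 + a x * k) / (1 + t) ^ (1 - α) := by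
        rw [hS' x, ha]; field_simp
      rw [this, Real.log_div (by positivity) hpt.ne', Real.log_mul hs.ne' hz.ne',
        Real.log_rpow ht1]
      ring
    rw [Finset.sum_congr rfl fun x _ => hterm x, Finset.sum_sub_distrib, Finset.sum_add_distrib,
      ← Finset.sum_mul, hP.2] at hm
    have hl : ∑ x, P x * (a x * ((1 - α) * t) / ((Q y0 + t) ^ α + M * ((1 - α) * t))) ≤
        ∑ x, P x * Real.log (1 + a x * k) :=
      Finset.sum_le_sum fun x _ =>
        mul_le_mul_of_nonneg_left (log_lower (ha0 x) hA hB.le (haM x) hgap) (hP.1 x)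
    have hlog : Real.log (1 + t) ≤ t := by
      have := Real.log_le_sub_one_of_pos ht1; linarith
    have hD : 0 < (Q y0 + t) ^ α + M * ((1 - α) * t) := by positivity
    have heq : ∑ x, P x * (a x * ((1 - α) * t) / ((Q y0 + t) ^ α + M * ((1 - α) * t))) =
        (∑ x, P x * a x) * ((1 - α) * t) / ((Q y0 + t) ^ α + M * ((1 - α) * t)) := by
      generalize (Q y0 + t) ^ α + M * ((1 - α) * t) = Dn
      rw [Finset.sum_mul, Finset.sum_div]
      refine Finset.sum_congr rfl fun x _ => ?_
      ring
    rw [heq] at hl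
    have hfin : (∑ x, P x * a x) * ((1 - α) * t) / ((Q y0 + t) ^ α + M * ((1 - α) * t))
        ≤ (1 - α) * t := by
      have := mul_le_mul_of_nonneg_left hlog (show 0 ≤ 1 - α by linarith)
      linarith
    rw [div_le_iff₀ hD, mul_comm] at hfin
    exact le_of_mul_le_mul_left hfin hB
  have hlim : Filter.Tendsto (fun t : ℝ => (Q y0 + t) ^ α + M * ((1 - α) * t))
      (nhdsWithin 0 (Set.Ioi 0)) (nhds (Q y0 ^ α)) := by
    have hc : Continuous fun t : ℝ => (Q y0 + t) ^ α + M * ((1 - α) * t) := by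
      have : Continuous fun t : ℝ => (Q y0 + t) ^ α :=
        (continuous_const.add continuous_id).rpow_const fun _ => Or.inr h0.le
      fun_prop
    have := (hc.tendsto 0).mono_left (nhdsWithin_le_nhds (s := Set.Ioi 0))
    simpa using this
  refine ge_of_tendsto hlim ?_
  filter_upwards [self_mem_nhdsWithin] with t ht using key t ht

lemma eh_lt {X Y : Type*} [Fintype X] [Fintype Y] {α : ℝ} (h0 : 0 < α) (h1 : α < 1)
    {W : X → Y → ℝ} (hW : ∀ x, IsPMF (W x)) {P : X → ℝ} (hP : IsPMF P) {Q : Y → ℝ}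
    (hQ : IsPMF Q) (hS : ∀ x, P x ≠ 0 → 0 < rSum α (W x) Q)
    (hmin : ∀ Q', IsPMF Q' → (∀ x, P x ≠ 0 → 0 < rSum α (W x) Q') →
      ∑ x, P x * Real.log (rSum α (W x) Q') ≤ ∑ x, P x * Real.log (rSum α (W x) Q))
    {R : Y → ℝ} (hR : IsPMF R) (hSR : ∀ x, P x ≠ 0 → 0 < rSum α (W x) R) :
    0 < rSum α Q R ∧ ∑ x, P x * Real.log (rSum α (W x) R) ≤
      ∑ x, P x * Real.log (rSum α (W x) Q) + Real.log (rSum α Q R) := by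
  have hk := kkt h0 h1 hW hP hQ hS hmin
  have hsum : ∑ x, P x * (rSum α (W x) R / rSum α (W x) Q) ≤ rSum α Q R := by
    have : ∑ x, P x * (rSum α (W x) R / rSum α (W x) Q) =
        ∑ y, (∑ x, P x * (W x y ^ α / rSum α (W x) Q)) * R y ^ (1 - α) := by
      simp_rw [Finset.sum_mul]
      rw [Finset.sum_comm]
      refine Finset.sum_congr rfl fun x _ => ?_
      conv_lhs => rw [rSum]
      rw [Finset.sum_div, Finset.mul_sum]
      refine Finset.sum_congr rfl fun y _ => ?_
      ring
    rw [this]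
    exact Finset.sum_le_sum fun y _ =>
      mul_le_mul_of_nonneg_right (hk y) (Real.rpow_nonneg (hR.1 y) _)
  obtain ⟨x0, hx0⟩ : ∃ x, P x ≠ 0 := by
    by_contra! h
    have := hP.2
    simp [h] at this
  have hnn : ∀ x, 0 ≤ P x * (rSum α (W x) R / rSum α (W x) Q) := fun x =>
    mul_nonneg (hP.1 x) (div_nonneg (rSum_nonneg (hW x).1 hR.1) (rSum_nonneg (hW x).1 hQ.1))
  have hT : 0 < rSum α Q R := by
    have hp : 0 < P x0 := lt_of_le_of_ne (hP.1 x0) (Ne.symm hx0)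
    have h2 : 0 < P x0 * (rSum α (W x0) R / rSum α (W x0) Q) :=
      mul_pos hp (div_pos (hSR x0 hx0) (hS x0 hx0))
    have h3 := Finset.single_le_sum (fun i _ => hnn i) (Finset.mem_univ x0)
    linarith
  refine ⟨hT, ?_⟩
  have hterm : ∀ x, P x * Real.log (rSum α (W x) R) ≤ P x * Real.log (rSum α (W x) Q) +
      P x * (Real.log (rSum α Q R) - 1) +
      P x * (rSum α (W x) R / rSum α (W x) Q) / rSum α Q R := by
    intro x
    by_cases hx : P x = 0
    · simp [hx]
    have hs := hS x hx
    have hr := hSR x hx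
    have h := Real.log_le_sub_one_of_pos
      (show 0 < rSum α (W x) R / rSum α (W x) Q / rSum α Q R by positivity)
    rw [Real.log_div (by positivity) hT.ne', Real.log_div hr.ne' hs.ne'] at h
    have := mul_le_mul_of_nonneg_left h (hP.1 x)
    rw [mul_div_assoc]
    nlinarith
  have := Finset.sum_le_sum fun x (_ : x ∈ Finset.univ) => hterm x
  rw [Finset.sum_add_distrib, Finset.sum_add_distrib, ← Finset.sum_mul, hP.2,
    ← Finset.sum_div] at this
  have h2 := (div_le_one hT).2 hsum
  linarith

end AugAux

namespace AugAux

lemma kl_split {X Y : Type*} [Fintype X] [Fintype Y] {W : X → Y → ℝ} {P : X → ℝ} {R : Y → ℝ}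
    (hac : ∀ x, P x ≠ 0 → ∀ y, R y = 0 → W x y = 0) :
    ∑ x, P x * ∑ y, W x y * Real.log (W x y / R y) =
      ∑ x, P x * ∑ y, W x y * Real.log (W x y) - ∑ y, (∑ x, P x * W x y) * Real.log (R y) := by
  have : ∑ y, (∑ x, P x * W x y) * Real.log (R y) =
      ∑ x, P x * ∑ y, W x y * Real.log (R y) := by
    simp_rw [Finset.sum_mul, Finset.mul_sum]
    rw [Finset.sum_comm]
    refine Finset.sum_congr rfl fun x _ => Finset.sum_congr rfl fun y _ => by ring
  rw [this, ← Finset.sum_sub_distrib]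
  refine Finset.sum_congr rfl fun x _ => ?_
  by_cases hx : P x = 0
  · simp [hx]
  rw [← mul_sub, ← Finset.sum_sub_distrib]
  congr 1
  refine Finset.sum_congr rfl fun y _ => ?_
  by_cases hw : W x y = 0
  · simp [hw]
  have hr : R y ≠ 0 := fun h => hw (hac x hx y h)
  rw [Real.log_div hw hr]; ring

lemma gibbs_eq {Y : Type*} [Fintype Y] {m Q : Y → ℝ} (hm : IsPMF m) (hQ : IsPMF Q)
    (hac : ∀ y, Q y = 0 → m y = 0)
    (h : ∑ y, m y * Real.log (m y) ≤ ∑ y, m y * Real.log (Q y)) : m = Q := by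
  have hterm : ∀ y, m y * Real.log (Q y) - m y * Real.log (m y) ≤
      2 * (√(m y) * √(Q y)) - 2 * m y := by
    intro y
    by_cases h0 : m y = 0
    · simp [h0]
    have hmp : 0 < m y := lt_of_le_of_ne (hm.1 y) (Ne.symm h0)
    have hqp : 0 < Q y := lt_of_le_of_ne (hQ.1 y) (fun h => h0 (hac y h.symm))
    have hs := Real.sqrt_pos.2 hmp
    have hsq := Real.sqrt_pos.2 hqp
    have hl := Real.log_le_sub_one_of_pos (div_pos hsq hs)
    rw [Real.log_div hsq.ne' hs.ne', Real.log_sqrt hqp.le, Real.log_sqrt hmp.le] at hl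
    have h2 := mul_le_mul_of_nonneg_left hl hmp.le
    have h3 : m y * (√(Q y) / √(m y)) = √(m y) * √(Q y) := by
      have : m y = √(m y) * √(m y) := (Real.mul_self_sqrt hmp.le).symm
      field_simp
      rw [sq, ← this]
    nlinarith
  have hs := Finset.sum_le_sum fun y (_ : y ∈ Finset.univ) => hterm y
  rw [Finset.sum_sub_distrib, Finset.sum_sub_distrib, ← Finset.mul_sum, ← Finset.mul_sum,
    hm.2] at hs
  have hsq : ∑ y, (√(m y) - √(Q y)) ^ 2 = 2 - 2 * ∑ y, √(m y) * √(Q y) := by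
    have : ∀ y, (√(m y) - √(Q y)) ^ 2 = m y + Q y - 2 * (√(m y) * √(Q y)) := by
      intro y
      have h1 := Real.mul_self_sqrt (hm.1 y)
      have h2 := Real.mul_self_sqrt (hQ.1 y)
      nlinarith
    rw [Finset.sum_congr rfl fun y _ => this y, Finset.sum_sub_distrib, Finset.sum_add_distrib,
      hm.2, hQ.2, ← Finset.mul_sum]
    norm_num
  have hz : ∑ y, (√(m y) - √(Q y)) ^ 2 = 0 :=
    le_antisymm (by linarith) (Finset.sum_nonneg fun y _ => sq_nonneg _)
  rw [Finset.sum_eq_zero_iff_of_nonneg fun y _ => sq_nonneg _] at hz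
  funext y
  have h1 := hz y (Finset.mem_univ y)
  have h2 : √(m y) = √(Q y) := by
    have := pow_eq_zero_iff (two_ne_zero) |>.1 h1
    linarith
  exact (Real.sqrt_inj (hm.1 y) (hQ.1 y)).1 h2

lemma eh_one {X Y : Type*} [Fintype X] [Fintype Y]
    {W : X → Y → ℝ} (hW : ∀ x, IsPMF (W x)) {P : X → ℝ} (hP : IsPMF P) {Q : Y → ℝ}
    (hQ : IsPMF Q) (hac : ∀ x, P x ≠ 0 → ∀ y, Q y = 0 → W x y = 0)
    (hmin : ∀ Q', IsPMF Q' → (∀ x, P x ≠ 0 → ∀ y, Q' y = 0 → W x y = 0) →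
      ∑ x, P x * ∑ y, W x y * Real.log (W x y / Q y) ≤
        ∑ x, P x * ∑ y, W x y * Real.log (W x y / Q' y))
    {R : Y → ℝ} (hacR : ∀ x, P x ≠ 0 → ∀ y, R y = 0 → W x y = 0) :
    (∀ y, R y = 0 → Q y = 0) ∧
      ∑ x, P x * ∑ y, W x y * Real.log (W x y / Q y) + ∑ y, Q y * Real.log (Q y / R y) =
        ∑ x, P x * ∑ y, W x y * Real.log (W x y / R y) := by
  set m : Y → ℝ := fun y => ∑ x, P x * W x y with hmdef
  have hnn : ∀ x y, 0 ≤ P x * W x y := fun x y => mul_nonneg (hP.1 x) ((hW x).1 y)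
  have hm : IsPMF m := by
    refine ⟨fun y => Finset.sum_nonneg fun x _ => hnn x y, ?_⟩
    rw [hmdef, Finset.sum_comm]
    simp_rw [← Finset.mul_sum, (hW _).2, mul_one]
    exact hP.2
  have hacm : ∀ x, P x ≠ 0 → ∀ y, m y = 0 → W x y = 0 := by
    intro x hx y hy
    rw [hmdef] at hy
    simp only at hy
    rw [Finset.sum_eq_zero_iff_of_nonneg fun x _ => hnn x y] at hy
    exact (mul_eq_zero.1 (hy x (Finset.mem_univ x))).resolve_left hx
  have hmac : ∀ S : Y → ℝ, (∀ x, P x ≠ 0 → ∀ y, S y = 0 → W x y = 0) →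
      ∀ y, S y = 0 → m y = 0 := by
    intro S hS y hy
    refine Finset.sum_eq_zero fun x _ => ?_
    by_cases hx : P x = 0
    · simp [hx]
    · simp [hS x hx y hy]
  have hmm := hmin m hm hacm
  rw [kl_split hac, kl_split hacm] at hmm
  have heq : m = Q := gibbs_eq hm hQ (hmac Q hac) (by
    simp only [hmdef] at hmm ⊢
    linarith)
  have hRQ : ∀ y, R y = 0 → Q y = 0 := by rw [← heq]; exact hmac R hacR
  refine ⟨hRQ, ?_⟩
  rw [kl_split hac, kl_split hacR]
  have hq : ∀ y, (∑ x, P x * W x y) = Q y := fun y => congrFun heq y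
  simp_rw [hq]
  have : ∑ y, Q y * Real.log (Q y / R y) =
      ∑ y, Q y * Real.log (Q y) - ∑ y, Q y * Real.log (R y) := by
    rw [← Finset.sum_sub_distrib]
    refine Finset.sum_congr rfl fun y _ => ?_
    by_cases h : Q y = 0
    · simp [h]
    rw [Real.log_div h (fun h' => h (hRQ y h'))]; ring
  rw [this]; ring

/-- Real-valued version of the divergence. -/
noncomputable def rr {Y : Type*} [Fintype Y] (α : ℝ) (W Q : Y → ℝ) : ℝ :=
  if α = 1 then ∑ y, W y * Real.log (W y / Q y) else 1 / (α - 1) * Real.log (rSum α W Q)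

lemma dA_coe {Y : Type*} [Fintype Y] {α : ℝ} {W Q : Y → ℝ} (h : dA α W Q ≠ ⊤) :
    dA α W Q = (rr α W Q : EReal) := by
  unfold dA rr kDiv rDiv at *
  split_ifs at h ⊢ with h1 h2 h3
  · congr 1
    refine Finset.sum_congr rfl fun y _ => ?_
    split_ifs with hy <;> simp [hy]
  · exact absurd rfl h
  · exact absurd rfl h
  · rfl

lemma dA_one_iff {Y : Type*} [Fintype Y] {W Q : Y → ℝ} :
    dA 1 W Q ≠ ⊤ ↔ ∀ y, Q y = 0 → W y = 0 := by
  unfold dA kDiv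
  rw [if_pos rfl]
  split_ifs with h
  · exact ⟨fun _ => h, fun _ => EReal.coe_ne_top _⟩
  · exact ⟨fun h' => absurd rfl h', fun h' => absurd h' h⟩

lemma dA_lt_iff {Y : Type*} [Fintype Y] {α : ℝ} (hα : α ≠ 1) {W Q : Y → ℝ}
    (hW : IsPMF W) (hQ : IsPMF Q) :
    dA α W Q ≠ ⊤ ↔ 0 < rSum α W Q := by
  have := rSum_nonneg (α := α) hW.1 hQ.1
  unfold dA rDiv
  rw [if_neg hα]
  split_ifs with h
  · simp [h]
  · exact ⟨fun _ => lt_of_le_of_ne this (Ne.symm h), fun _ => EReal.coe_ne_top _⟩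

lemma dA_ne_bot {Y : Type*} [Fintype Y] {α : ℝ} {W Q : Y → ℝ} : dA α W Q ≠ ⊥ := by
  by_cases h : dA α W Q = ⊤
  · rw [h]; simp
  · rw [dA_coe h]; simp

lemma coe_sum_real {X : Type*} (s : Finset X) (f : X → ℝ) :
    ((∑ x ∈ s, f x : ℝ) : EReal) = ∑ x ∈ s, (f x : EReal) := by
  classical
  induction s using Finset.induction_on with
  | empty => simp
  | insert a s ha ih => rw [Finset.sum_insert ha, Finset.sum_insert ha, EReal.coe_add, ih]

lemma cDiv_coe {X Y : Type*} [Fintype X] [Fintype Y] {α : ℝ} {W : X → Y → ℝ} {Q : Y → ℝ}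
    {P : X → ℝ} (h : ∀ x, P x ≠ 0 → dA α (W x) Q ≠ ⊤) :
    cDiv α W Q P = ((∑ x, P x * rr α (W x) Q : ℝ) : EReal) := by
  unfold cDiv
  rw [coe_sum_real]
  refine Finset.sum_congr rfl fun x _ => ?_
  by_cases hx : P x = 0
  · simp [hx]
  · rw [dA_coe (h x hx), EReal.coe_mul]

lemma cDiv_fin {X Y : Type*} [Fintype X] [Fintype Y] {α : ℝ} {W : X → Y → ℝ} {Q : Y → ℝ}
    {P : X → ℝ} (hP : IsPMF P) (h : cDiv α W Q P ≠ ⊤) (x : X) (hx : P x ≠ 0) :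
    dA α (W x) Q ≠ ⊤ := by
  classical
  intro htop
  apply h
  unfold cDiv
  have hp : 0 < P x := lt_of_le_of_ne (hP.1 x) (Ne.symm hx)
  have hnb : ∀ z, (P z : EReal) * dA α (W z) Q ≠ ⊥ := by
    intro z
    by_cases hz : P z = 0
    · simp [hz]
    have hpz : 0 < P z := lt_of_le_of_ne (hP.1 z) (Ne.symm hz)
    by_cases ht : dA α (W z) Q = ⊤
    · rw [ht, EReal.coe_mul_top_of_pos hpz]; simp
    · rw [dA_coe ht, ← EReal.coe_mul]; exact EReal.coe_ne_bot _
  have hnbs : ∀ s : Finset X, ∑ z ∈ s, (P z : EReal) * dA α (W z) Q ≠ ⊥ := by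
    intro s
    induction s using Finset.induction_on with
    | empty => simp
    | insert a s ha ih =>
      rw [Finset.sum_insert ha]
      simp [EReal.add_eq_bot_iff, hnb a, ih]
  rw [← Finset.add_sum_erase _ _ (Finset.mem_univ x), htop, EReal.coe_mul_top_of_pos hp]
  exact EReal.top_add_of_ne_bot (hnbs _)

/-- Erven–Harremoës bound. -/
lemma eh {X Y : Type*} [Fintype X] [Fintype Y] {α : ℝ} (hα : α ∈ Set.Ioc (0 : ℝ) 1)
    {W : X → Y → ℝ} (hW : ∀ x, IsPMF (W x)) {P : X → ℝ} (hP : IsPMF P) {Q : Y → ℝ}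
    (hQ : IsPMF Q) (hfin : cDiv α W Q P ≠ ⊤)
    (hmin : ∀ Q', IsPMF Q' → cDiv α W Q P ≤ cDiv α W Q' P)
    {R : Y → ℝ} (hR : IsPMF R) : dA α Q R + cDiv α W Q P ≤ cDiv α W R P := by
  by_cases hRt : cDiv α W R P = ⊤
  · rw [hRt]; exact le_top
  have fQ := cDiv_fin hP hfin
  have fR := cDiv_fin hP hRt
  have hmin' : ∀ Q', IsPMF Q' → (∀ x, P x ≠ 0 → dA α (W x) Q' ≠ ⊤) →
      ∑ x, P x * rr α (W x) Q ≤ ∑ x, P x * rr α (W x) Q' := by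
    intro Q' hQ' hf
    have := hmin Q' hQ'
    rw [cDiv_coe fQ, cDiv_coe hf] at this
    exact_mod_cast this
  rw [cDiv_coe fQ, cDiv_coe fR]
  rcases eq_or_lt_of_le hα.2 with h1 | h1
  · subst h1
    obtain ⟨ha, hb⟩ := eh_one hW hP hQ (fun x hx => dA_one_iff.1 (fQ x hx))
      (fun Q' hQ' hf => by
        have := hmin' Q' hQ' (fun x hx => dA_one_iff.2 (hf x hx))
        simpa [rr] using this)
      (R := R) (fun x hx => dA_one_iff.1 (fR x hx))
    rw [dA_coe (dA_one_iff.2 ha), ← EReal.coe_add, EReal.coe_le_coe_iff]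
    simp only [rr, if_true]
    linarith
  · have hne := h1.ne
    have hneg : 1 / (α - 1) < 0 := one_div_neg.2 (by linarith)
    have e : ∀ S : Y → ℝ, ∑ x, P x * rr α (W x) S =
        1 / (α - 1) * ∑ x, P x * Real.log (rSum α (W x) S) := by
      intro S
      rw [Finset.mul_sum]
      refine Finset.sum_congr rfl fun x _ => ?_
      simp only [rr, if_neg hne]; ring
    obtain ⟨ha, hb⟩ := eh_lt hα.1 h1 hW hP hQ
      (fun x hx => (dA_lt_iff hne (hW x) hQ).1 (fQ x hx))
      (fun Q' hQ' hf => by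
        have := hmin' Q' hQ' (fun x hx => (dA_lt_iff hne (hW x) hQ').2 (hf x hx))
        rw [e, e] at this
        exact (mul_le_mul_left_of_neg hneg).1 this) hR
      (fun x hx => (dA_lt_iff hne (hW x) hR).1 (fR x hx))
    rw [dA_coe ((dA_lt_iff hne hQ hR).2 ha), ← EReal.coe_add, EReal.coe_le_coe_iff, e, e]
    have := mul_le_mul_of_nonpos_left hb hneg.le
    simp only [rr, if_neg hne]
    linarith

end AugAux

namespace AugAux

lemma rSum_pos {Y : Type*} [Fintype Y] {α : ℝ} {W Q : Y → ℝ} (hW : IsPMF W)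
    (hQ : ∀ y, 0 < Q y) : 0 < rSum α W Q := by
  obtain ⟨y, hy⟩ : ∃ y, W y ≠ 0 := by
    by_contra! h
    have := hW.2
    simp [h] at this
  have hyp : 0 < W y := lt_of_le_of_ne (hW.1 y) (Ne.symm hy)
  refine Finset.sum_pos' (fun z _ => mul_nonneg (Real.rpow_nonneg (hW.1 z) _)
    (Real.rpow_nonneg (hQ z).le _)) ⟨y, Finset.mem_univ y, ?_⟩
  exact mul_pos (Real.rpow_pos_of_pos hyp _) (Real.rpow_pos_of_pos (hQ y) _)

lemma dA_fin {Y : Type*} [Fintype Y] {α : ℝ} {W Q : Y → ℝ} (hW : IsPMF W) (hQ : IsPMF Q)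
    (hQp : ∀ y, 0 < Q y) : dA α W Q ≠ ⊤ := by
  by_cases h : α = 1
  · subst h
    exact dA_one_iff.2 fun y hy => absurd hy (hQp y).ne'
  · exact (dA_lt_iff h hW hQ).2 (rSum_pos hW hQp)

/-- Output distributions bounded below by `c`. -/
def KK (Y : Type*) [Fintype Y] (c : ℝ) : Set (Y → ℝ) := {Q | IsPMF Q ∧ ∀ y, c ≤ Q y}

lemma KK_convex (Y : Type*) [Fintype Y] (c : ℝ) : Convex ℝ (KK Y c) := by
  intro Q1 h1 Q2 h2 a b ha hb hab
  refine ⟨⟨fun y => ?_, ?_⟩, fun y => ?_⟩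
  · have := mul_nonneg ha (h1.1.1 y)
    have := mul_nonneg hb (h2.1.1 y)
    simp only [Pi.add_apply, Pi.smul_apply, smul_eq_mul]
    linarith
  · simp only [Pi.add_apply, Pi.smul_apply, smul_eq_mul]
    rw [Finset.sum_add_distrib, ← Finset.mul_sum, ← Finset.mul_sum, h1.1.2, h2.1.2]
    linarith
  · have e1 := mul_le_mul_of_nonneg_left (h1.2 y) ha
    have e2 := mul_le_mul_of_nonneg_left (h2.2 y) hb
    simp only [Pi.add_apply, Pi.smul_apply, smul_eq_mul]
    have : c = a * c + b * c := by rw [← add_mul, hab, one_mul]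
    linarith

lemma KK_compact (Y : Type*) [Fintype Y] (c : ℝ) : IsCompact (KK Y c) := by
  have : KK Y c = stdSimplex ℝ Y ∩ ⋂ y, {Q : Y → ℝ | c ≤ Q y} := by
    ext Q
    simp [KK, IsPMF, stdSimplex]
  rw [this]
  exact (isCompact_stdSimplex ℝ Y).inter_right
    (isClosed_iInter fun y => isClosed_le continuous_const (continuous_apply y))

lemma rr_cont {Y : Type*} [Fintype Y] {α : ℝ} {W : Y → ℝ} (hW : IsPMF W) {c : ℝ} (hc : 0 < c) :
    ContinuousOn (rr α W) (KK Y c) := by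
  have hpos : ∀ Q ∈ KK Y c, ∀ y, 0 < Q y := fun Q hQ y => lt_of_lt_of_le hc (hQ.2 y)
  unfold rr
  split_ifs with h
  · refine continuousOn_finsetSum _ fun y _ => ?_
    by_cases hw : W y = 0
    · simp only [hw, zero_mul]; exact continuousOn_const
    refine continuousOn_const.mul (ContinuousOn.log ?_ ?_)
    · exact continuousOn_const.div (continuous_apply y).continuousOn
        fun Q hQ => (hpos Q hQ y).ne'
    · exact fun Q hQ => div_ne_zero hw (hpos Q hQ y).ne'
  · refine continuousOn_const.mul (ContinuousOn.log ?_ ?_)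
    · unfold rSum
      refine continuousOn_finsetSum _ fun y _ => continuousOn_const.mul ?_
      exact (continuous_apply y).continuousOn.rpow_const fun Q hQ => Or.inl (hpos Q hQ y).ne'
    · exact fun Q hQ => (rSum_pos hW (hpos Q hQ)).ne'

lemma rr_convex {Y : Type*} [Fintype Y] {α : ℝ} (hα : α ∈ Set.Ioc (0 : ℝ) 1)
    {W : Y → ℝ} (hW : IsPMF W) {c : ℝ} (hc : 0 < c) :
    ConvexOn ℝ (KK Y c) (rr α W) := by
  refine ⟨KK_convex Y c, ?_⟩
  intro Q1 h1 Q2 h2 a b ha hb hab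
  have hpos : ∀ Q ∈ KK Y c, ∀ y, 0 < Q y := fun Q hQ y => lt_of_lt_of_le hc (hQ.2 y)
  have p1 := hpos Q1 h1
  have p2 := hpos Q2 h2
  have p3 := hpos _ (KK_convex Y c h1 h2 ha hb hab)
  unfold rr
  split_ifs with h
  · simp only [smul_eq_mul]
    rw [Finset.mul_sum, Finset.mul_sum, ← Finset.sum_add_distrib]
    refine Finset.sum_le_sum fun y _ => ?_
    by_cases hw : W y = 0
    · simp [hw]
    rw [Real.log_div hw (p1 y).ne', Real.log_div hw (p2 y).ne', Real.log_div hw (p3 y).ne']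
    have hl := strictConcaveOn_log_Ioi.concaveOn.2 (Set.mem_Ioi.2 (p1 y)) (Set.mem_Ioi.2 (p2 y))
      ha hb hab
    simp only [smul_eq_mul] at hl
    simp only [Pi.add_apply, Pi.smul_apply, smul_eq_mul]
    have := mul_le_mul_of_nonneg_left hl (hW.1 y)
    have e : W y * Real.log (W y) = a * (W y * Real.log (W y)) + b * (W y * Real.log (W y)) := by
      rw [← add_mul, hab, one_mul]
    linarith
  · have h1' : α < 1 := lt_of_le_of_ne hα.2 h
    have hneg : 1 / (α - 1) < 0 := one_div_neg.2 (by linarith)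
    have s1 := rSum_pos (α := α) hW p1
    have s2 := rSum_pos (α := α) hW p2
    have hS : a * rSum α W Q1 + b * rSum α W Q2 ≤ rSum α W (a • Q1 + b • Q2) := by
      unfold rSum
      rw [Finset.mul_sum, Finset.mul_sum, ← Finset.sum_add_distrib]
      refine Finset.sum_le_sum fun y _ => ?_
      have hl := (Real.concaveOn_rpow (p := 1 - α) (by linarith) (by linarith [hα.1])).2
        (Set.mem_Ici.2 (p1 y).le) (Set.mem_Ici.2 (p2 y).le) ha hb hab
      simp only [smul_eq_mul] at hl
      simp only [Pi.add_apply, Pi.smul_apply, smul_eq_mul]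
      have := mul_le_mul_of_nonneg_left hl (Real.rpow_nonneg (hW.1 y) α)
      linarith
    have hl := strictConcaveOn_log_Ioi.concaveOn.2 (Set.mem_Ioi.2 s1) (Set.mem_Ioi.2 s2)
      ha hb hab
    simp only [smul_eq_mul] at hl ⊢
    have hp : 0 < a * rSum α W Q1 + b * rSum α W Q2 := by
      rcases eq_or_lt_of_le ha with h | h
      · have : b = 1 := by linarith
        rw [← h, this]; linarith
      · have := mul_pos h s1
        have := mul_nonneg hb s2.le
        linarith
    have hl2 := Real.log_le_log hp hS
    have := mul_le_mul_of_nonpos_left (hl.trans hl2) hneg.le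
    linarith

lemma rr_mix {Y : Type*} [Fintype Y] {α : ℝ} (hα : α ∈ Set.Ioc (0 : ℝ) 1)
    {W : Y → ℝ} (hW : IsPMF W) {Q Q' : Y → ℝ} (hQ : IsPMF Q) (hfin : dA α W Q ≠ ⊤)
    {δ : ℝ} (hδ : δ < 1)
    (hmix : ∀ y, (1 - δ) * Q y ≤ Q' y) : rr α W Q' ≤ rr α W Q - Real.log (1 - δ) := by
  have hd : 0 < 1 - δ := by linarith
  by_cases h : α = 1
  · subst h
    rw [dA_one_iff] at hfin
    simp only [rr, if_true]
    have e : Real.log (1 - δ) = ∑ y, W y * Real.log (1 - δ) := by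
      rw [← Finset.sum_mul, hW.2, one_mul]
    rw [e, ← Finset.sum_sub_distrib]
    refine Finset.sum_le_sum fun y _ => ?_
    by_cases hw : W y = 0
    · simp [hw]
    have hq : 0 < Q y := lt_of_le_of_ne (hQ.1 y) fun h => hw (hfin y h.symm)
    have hq' : 0 < Q' y := lt_of_lt_of_le (mul_pos hd hq) (hmix y)
    rw [← mul_sub, Real.log_div hw hq.ne', Real.log_div hw hq'.ne']
    have := Real.log_le_log (mul_pos hd hq) (hmix y)
    rw [Real.log_mul hd.ne' hq.ne'] at this
    exact mul_le_mul_of_nonneg_left (by linarith) (hW.1 y)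
  · have h1' : α < 1 := lt_of_le_of_ne hα.2 h
    have hneg : 1 / (α - 1) < 0 := one_div_neg.2 (by linarith)
    have hs := (dA_lt_iff h hW hQ).1 hfin
    simp only [rr, if_neg h]
    have hS : (1 - δ) ^ (1 - α) * rSum α W Q ≤ rSum α W Q' := by
      unfold rSum
      rw [Finset.mul_sum]
      refine Finset.sum_le_sum fun y _ => ?_
      have : ((1 - δ) * Q y) ^ (1 - α) ≤ Q' y ^ (1 - α) :=
        Real.rpow_le_rpow (mul_nonneg hd.le (hQ.1 y)) (hmix y) (by linarith)
      rw [Real.mul_rpow hd.le (hQ.1 y)] at this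
      have := mul_le_mul_of_nonneg_left this (Real.rpow_nonneg (hW.1 y) α)
      linarith
    have hp : 0 < (1 - δ) ^ (1 - α) := Real.rpow_pos_of_pos hd _
    have hl := Real.log_le_log (mul_pos hp hs) hS
    rw [Real.log_mul hp.ne' hs.ne', Real.log_rpow hd] at hl
    have := mul_le_mul_of_nonpos_left hl hneg.le
    have e : 1 / (α - 1) * ((1 - α) * Real.log (1 - δ) + Real.log (rSum α W Q)) =
        1 / (α - 1) * Real.log (rSum α W Q) - Real.log (1 - δ) := by
      have : α - 1 ≠ 0 := by linarith
      field_simp; ring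
    linarith

lemma minimax_delta {X Y : Type*} [Fintype X] [Fintype Y] [Nonempty Y]
    {α : ℝ} (hα : α ∈ Set.Ioc (0 : ℝ) 1)
    {W : X → Y → ℝ} (hW : ∀ x, IsPMF (W x))
    {C : Set (X → ℝ)} (hCpmf : ∀ P ∈ C, IsPMF P) (hCconv : Convex ℝ C)
    {QC : Y → ℝ}
    (hQCmin : ∀ Q : Y → ℝ, IsPMF Q →
      (⨆ P ∈ C, cDiv α W QC P) ≤ ⨆ P ∈ C, cDiv α W Q P)
    {δ : ℝ} (h0 : 0 < δ) (h1 : δ < 1) :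
    (⨆ P ∈ C, cDiv α W QC P) ≤ (⨆ P ∈ C, aInfo α P W) + ((-Real.log (1 - δ) : ℝ) : EReal) := by
  set n : ℝ := (Fintype.card Y : ℝ) with hn
  have hnpos : 0 < n := by rw [hn]; exact_mod_cast Fintype.card_pos
  set c := δ / n with hcdef
  have hc : 0 < c := div_pos h0 hnpos
  have hd : 0 < 1 - δ := by linarith
  have hmixK : ∀ Q : Y → ℝ, IsPMF Q → (fun y => (1 - δ) * Q y + c) ∈ KK Y c := by
    intro Q hQ
    refine ⟨⟨fun y => ?_, ?_⟩, fun y => ?_⟩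
    · have := mul_nonneg hd.le (hQ.1 y); linarith
    · rw [Finset.sum_add_distrib, ← Finset.mul_sum, hQ.2, Finset.sum_const, nsmul_eq_mul,
        Finset.card_univ, ← hn, hcdef]
      field_simp; ring
    · have := mul_nonneg hd.le (hQ.1 y); linarith
  have hU : IsPMF (fun _ : Y => 1 / n) := by
    refine ⟨fun y => by positivity, ?_⟩
    rw [Finset.sum_const, nsmul_eq_mul, Finset.card_univ, ← hn]
    field_simp
  have hKne : (KK Y c).Nonempty := ⟨_, hmixK _ hU⟩
  set g : (Y → ℝ) → (X → ℝ) → ℝ := fun Q P => ∑ x, P x * rr α (W x) Q with hg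
  have hcoe : ∀ Q ∈ KK Y c, ∀ P, cDiv α W Q P = (g Q P : EReal) := fun Q hQ P =>
    cDiv_coe fun x _ => dA_fin (hW x) hQ.1 fun y => lt_of_lt_of_le hc (hQ.2 y)
  have hmono : Monotone (fun r : ℝ => (r : EReal)) := fun a b h => EReal.coe_le_coe_iff.2 h
  have hmm : (⨅ Q ∈ KK Y c, ⨆ P ∈ C, (g Q P : EReal)) = ⨆ P ∈ C, ⨅ Q ∈ KK Y c, (g Q P : EReal) := by
    apply Sion.minimax' hKne (KK_convex Y c) (KK_compact Y c)
    · intro P hP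
      apply ContinuousOn.lowerSemicontinuousOn
      apply continuous_coe_real_ereal.comp_continuousOn
      exact continuousOn_finsetSum _ fun x _ => continuousOn_const.mul (rr_cont (hW x) hc)
    · intro P hP
      have : ConvexOn ℝ (KK Y c) (fun Q => g Q P) := by
        refine ⟨KK_convex Y c, ?_⟩
        intro Q1 h1 Q2 h2 a b ha hb hab
        simp only [hg, smul_eq_mul]
        rw [Finset.mul_sum, Finset.mul_sum, ← Finset.sum_add_distrib]
        refine Finset.sum_le_sum fun x _ => ?_
        have := (rr_convex hα (hW x) hc).2 h1 h2 ha hb hab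
        simp only [smul_eq_mul] at this
        have := mul_le_mul_of_nonneg_left this ((hCpmf P hP).1 x)
        linarith
      have h := QuasiconvexOn.monotone_comp (g := fun r : ℝ => (r : EReal)) hmono this.quasiconvexOn
      exact h
    · exact hCconv
    · intro Q hQ
      apply ContinuousOn.upperSemicontinuousOn
      apply continuous_coe_real_ereal.comp_continuousOn
      simp only [hg]
      fun_prop
    · intro Q hQ
      have : ConcaveOn ℝ C (fun P => g Q P) := by
        refine ⟨hCconv, ?_⟩
        intro P1 h1 P2 h2 a b ha hb hab
        simp only [hg, smul_eq_mul, Pi.add_apply, Pi.smul_apply]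
        rw [Finset.mul_sum, Finset.mul_sum, ← Finset.sum_add_distrib]
        refine le_of_eq (Finset.sum_congr rfl fun x _ => by ring)
      have h := QuasiconcaveOn.monotone_comp (g := fun r : ℝ => (r : EReal)) hmono this.quasiconcaveOn
      exact h
  have hstep1 : (⨆ P ∈ C, cDiv α W QC P) ≤ ⨅ Q ∈ KK Y c, ⨆ P ∈ C, (g Q P : EReal) := by
    refine le_iInf₂ fun Q hQ => (hQCmin Q hQ.1).trans ?_
    exact iSup₂_mono fun P hP => (hcoe Q hQ P).le
  rw [hmm] at hstep1
  refine hstep1.trans (iSup₂_le fun P hP => ?_)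
  have hstep2 : (⨅ Q ∈ KK Y c, (g Q P : EReal)) - ((-Real.log (1 - δ) : ℝ) : EReal) ≤
      aInfo α P W := by
    refine le_iInf₂ fun Q hQ => ?_
    rw [EReal.sub_le_iff_le_add (Or.inl (EReal.coe_ne_bot _)) (Or.inl (EReal.coe_ne_top _))]
    refine (iInf₂_le _ (hmixK Q hQ)).trans ?_
    by_cases ht : cDiv α W Q P = ⊤
    · rw [ht, EReal.top_add_of_ne_bot (EReal.coe_ne_bot _)]; exact le_top
    have hf := cDiv_fin (hCpmf P hP) ht
    rw [cDiv_coe hf, ← EReal.coe_add, EReal.coe_le_coe_iff]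
    have : -Real.log (1 - δ) = ∑ x, P x * (-Real.log (1 - δ)) := by
      rw [← Finset.sum_mul, (hCpmf P hP).2, one_mul]
    rw [this, ← Finset.sum_add_distrib]
    refine Finset.sum_le_sum fun x _ => ?_
    by_cases hx : P x = 0
    · simp [hx]
    rw [← mul_add]
    refine mul_le_mul_of_nonneg_left ?_ ((hCpmf P hP).1 x)
    rw [← sub_eq_add_neg]
    exact rr_mix hα (hW x) hQ (hf x hx) h1 fun y => by simpa using hc.le
  rw [EReal.sub_le_iff_le_add (Or.inl (EReal.coe_ne_bot _)) (Or.inl (EReal.coe_ne_top _))] at hstep2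
  refine hstep2.trans ?_
  gcongr
  exact le_iSup₂ (f := fun P (_ : P ∈ C) => aInfo α P W) P hP

end AugAux

/-- distance of the Augustin mean of a prior in `C` to the Augustin center
is controlled by the capacity gap. -/
theorem augustin_center_mean_bound {X Y : Type*} [Fintype X] [Fintype Y]
    [Nonempty X] [Nonempty Y]
    (α : ℝ) (hα : α ∈ Set.Ioc (0 : ℝ) 1)
    (W : X → Y → ℝ) (hW : ∀ x, IsPMF (W x))
    (C : Set (X → ℝ)) (hCne : C.Nonempty) (hCpmf : ∀ P ∈ C, IsPMF P)
    (hCconv : Convex ℝ C)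
    (hfin : (⨆ P ∈ C, aInfo α P W) ≠ ⊤)
    (QC : Y → ℝ) (hQC : IsPMF QC)
    (hQCmin : ∀ Q : Y → ℝ, IsPMF Q →
      (⨆ P ∈ C, cDiv α W QC P) ≤ ⨆ P ∈ C, cDiv α W Q P)
    (P : X → ℝ) (hP : P ∈ C)
    (QaP : Y → ℝ) (hQaP : IsPMF QaP)
    (hQaPmin : ∀ Q : Y → ℝ, IsPMF Q → cDiv α W QaP P ≤ cDiv α W Q P) :
    (⨆ P' ∈ C, aInfo α P' W) - aInfo α P W ≥ dA α QaP QC := by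
  have hPp := hCpmf P hP
  have haI : aInfo α P W = cDiv α W QaP P :=
    le_antisymm (iInf₂_le _ hQaP) (le_iInf₂ fun Q hQ => hQaPmin Q hQ)
  have hle : aInfo α P W ≤ ⨆ P' ∈ C, aInfo α P' W :=
    le_iSup₂ (f := fun P' (_ : P' ∈ C) => aInfo α P' W) P hP
  have hnt : aInfo α P W ≠ ⊤ := ne_top_of_le_ne_top hfin hle
  have hnt' : cDiv α W QaP P ≠ ⊤ := haI ▸ hnt
  have hnb : aInfo α P W ≠ ⊥ := by
    rw [haI, AugAux.cDiv_coe (AugAux.cDiv_fin hPp hnt')]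
    exact EReal.coe_ne_bot _
  have hsaddle : (⨆ P' ∈ C, cDiv α W QC P') ≤ ⨆ P' ∈ C, aInfo α P' W := by
    have hcb : (⨆ P' ∈ C, aInfo α P' W) ≠ ⊥ := ne_bot_of_le_ne_bot hnb hle
    have hd := fun δ h0 h1 => AugAux.minimax_delta hα hW hCpmf hCconv hQCmin (δ := δ) h0 h1
    obtain ⟨c, hc⟩ : ∃ c : ℝ, (⨆ P' ∈ C, aInfo α P' W) = (c : EReal) :=
      ⟨_, (EReal.coe_toReal hfin hcb).symm⟩
    rw [hc] at hd ⊢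
    have hlim : Filter.Tendsto (fun δ : ℝ => ((c + -Real.log (1 - δ) : ℝ) : EReal))
        (nhdsWithin 0 (Set.Ioi 0)) (nhds (c : EReal)) := by
      have h2 : ContinuousAt (fun δ : ℝ => ((c + -Real.log (1 - δ) : ℝ) : EReal)) 0 := by
        apply continuous_coe_real_ereal.continuousAt.comp
        apply ContinuousAt.add continuousAt_const
        apply ContinuousAt.neg
        apply ContinuousAt.log
        · fun_prop
        · norm_num
      have := h2.tendsto.mono_left (nhdsWithin_le_nhds (s := Set.Ioi 0))
      simpa using this
    refine ge_of_tendsto hlim ?_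
    filter_upwards [Ioo_mem_nhdsGT (show (0 : ℝ) < 1 by norm_num)] with δ hδ
    rw [EReal.coe_add]
    exact hd δ hδ.1 hδ.2
  rw [ge_iff_le, EReal.le_sub_iff_add_le (Or.inl hnb) (Or.inl hnt), haI]
  refine (AugAux.eh hα hW hPp hQaP hnt' hQaPmin hQC).trans (le_trans ?_ hsaddle)
  exact le_iSup₂ (f := fun P' (_ : P' ∈ C) => cDiv α W QC P') P hP
end
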